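/- Let (X,d,m) be a length PI space having the deformation property, let Ω ⊆ X be open, and let E ⊆ X be a set of locally finite perimeter that is a volume-constrained minimizer of the perimeter in Ω, meaning that P(E,K) ≤ P(F,K) whenever F ⊆ X is Borel, K ⊆ Ω is compact, m((E Δ F) \ K) = 0 and m(E ∩ K) = m(F ∩ K). Assume P(E,Ω) > 0. Then E^(1) ∩ Ω and E^(0) ∩ Ω are open sets and ∂E^(1) ∩ Ω = ∂E^(0) ∩ Ω = ∂^e E ∩ Ω. -/

import Mathlib

open MeasureTheory Metric Set Filter Topology ENNReal Bornology
open scoped symmDiff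

noncomputable section

variable {X : Type*}

/-- The slope (pointwise Lipschitz constant) of `f` at `x`, computed within `Ω`.
It vanishes at points that are isolated in `Ω`. -/
def slopeOn [MetricSpace X] (Ω : Set X) (f : X → ℝ) (x : X) : ℝ≥0∞ :=
  Filter.limsup (fun y => ENNReal.ofReal (|f x - f y| / dist x y)) (𝓝[Ω \ {x}] x)

/-- The slope of `f`. -/
def mSlope [MetricSpace X] (f : X → ℝ) (x : X) : ℝ≥0∞ := slopeOn Set.univ f x

/-- `f` is locally Lipschitz on `Ω`. -/
def LocLipOn [MetricSpace X] (Ω : Set X) (f : X → ℝ) : Prop :=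
  ∀ x ∈ Ω, ∃ r > (0:ℝ), ∃ K : NNReal, LipschitzOnWith K f (Metric.ball x r ∩ Ω)

/-- Convergence `fn → f` in `L¹_loc(Ω)` w.r.t. the measure `m`. -/
def TendstoL1loc [MetricSpace X] [MeasurableSpace X] (m : Measure X) (Ω : Set X)
    (fn : ℕ → X → ℝ) (f : X → ℝ) : Prop :=
  ∀ K : Set X, K ⊆ Ω → IsCompact K →
    Tendsto (fun n => ∫⁻ x in K, ENNReal.ofReal |fn n x - f x| ∂m) atTop (𝓝 0)

/-- The total variation `|Df|(B)` of `f : X → ℝ` on the set `B`. -/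
def totVar [MetricSpace X] [MeasurableSpace X] (m : Measure X) (f : X → ℝ) (B : Set X) : ℝ≥0∞ :=
  ⨅ (Ω : Set X) (_ : IsOpen Ω) (_ : B ⊆ Ω),
    ⨅ (fn : ℕ → X → ℝ) (_ : ∀ n, LocLipOn Ω (fn n)) (_ : TendstoL1loc m Ω fn f),
      Filter.liminf (fun n => ∫⁻ x in Ω, slopeOn Ω (fn n) x ∂m) atTop

/-- The perimeter `P(E, B)` of a set `E` in `B`. -/
def Per [MetricSpace X] [MeasurableSpace X] (m : Measure X) (E B : Set X) : ℝ≥0∞ :=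
  totVar m (Set.indicator E fun _ => (1:ℝ)) B

/-- `E` has locally finite perimeter. -/
def HasLocFinPer [MetricSpace X] [MeasurableSpace X] (m : Measure X) (E : Set X) : Prop :=
  ∀ x : X, ∃ r > (0:ℝ), Per m E (Metric.ball x r) < ∞

/-- `E` has finite perimeter. -/
def HasFinPer [MetricSpace X] [MeasurableSpace X] (m : Measure X) (E : Set X) : Prop :=
  Per m E Set.univ < ∞

/-- `m` is finite on bounded sets. -/
def BoundedlyFinite [MetricSpace X] [MeasurableSpace X] (m : Measure X) : Prop :=
  ∀ B : Set X, Bornology.IsBounded B → m B < ∞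

/-- Uniformly locally doubling with doubling function `C_D`. -/
def UnifLocDoublingWith [MetricSpace X] [MeasurableSpace X] (C_D : ℝ → ℝ) (m : Measure X) : Prop :=
  ∀ R : ℝ, 0 < R → ∀ x : X, ∀ r : ℝ, 0 < r → r < R →
    m (Metric.ball x (2 * r)) ≤ ENNReal.ofReal (C_D R) * m (Metric.ball x r)

/-- Weak local (1,1)-Poincaré inequality with dilation `lam` and constant function `C_P`. -/
def WeakPoincareWith [MetricSpace X] [MeasurableSpace X] (lam : ℝ) (C_P : ℝ → ℝ)
    (m : Measure X) : Prop :=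
  ∀ f : X → ℝ, LocLipOn Set.univ f → ∀ R : ℝ, 0 < R → ∀ x : X, ∀ r : ℝ, 0 < r → r < R →
    (∫⁻ y in Metric.ball x r,
        ENNReal.ofReal |f y - ⨍ z in Metric.ball x r, f z ∂m| ∂m) / m (Metric.ball x r)
      ≤ ENNReal.ofReal (C_P R * r) *
          ((∫⁻ y in Metric.ball x (lam * r), mSlope f y ∂m) / m (Metric.ball x (lam * r)))

/-- `(X, d, m)` is a PI space. -/
def IsPIspace [MetricSpace X] [MeasurableSpace X] (m : Measure X) : Prop :=
  (∃ C_D : ℝ → ℝ, (∀ R, 0 < R → 0 < C_D R) ∧ UnifLocDoublingWith C_D m) ∧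
  (∃ lam : ℝ, 1 ≤ lam ∧ ∃ C_P : ℝ → ℝ, (∀ R, 0 < R → 0 < C_P R) ∧ WeakPoincareWith lam C_P m)

/-- `(X, d)` is a length space: the distance between two points is the infimum of the
lengths of continuous curves joining them. -/
def IsLengthSpace (X : Type*) [MetricSpace X] : Prop :=
  ∀ p q : X, ENNReal.ofReal (dist p q) =
    ⨅ (γ : ℝ → X) (_ : ContinuousOn γ (Set.Icc 0 1)) (_ : γ 0 = p) (_ : γ 1 = q),
      eVariationOn γ (Set.Icc 0 1)

/-- Essential interior `E^{(1)}`. -/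
def essInt [MetricSpace X] [MeasurableSpace X] (m : Measure X) (E : Set X) : Set X :=
  { x | Tendsto (fun r : ℝ => m (E ∩ Metric.ball x r) / m (Metric.ball x r)) (𝓝[>] 0) (𝓝 1) }

/-- Essential exterior `E^{(0)}`. -/
def essExt [MetricSpace X] [MeasurableSpace X] (m : Measure X) (E : Set X) : Set X :=
  { x | Tendsto (fun r : ℝ => m (E ∩ Metric.ball x r) / m (Metric.ball x r)) (𝓝[>] 0) (𝓝 0) }

/-- Essential boundary `∂^e E`. -/
def essBdry [MetricSpace X] [MeasurableSpace X] (m : Measure X) (E : Set X) : Set X :=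
  (essInt m E ∪ essExt m E)ᶜ

/-- The two deformation inequalities hold for `E` at `x` with radius `R` and constant `C`. -/
def DeformIneq [MetricSpace X] [MeasurableSpace X] (m : Measure X) (E : Set X) (x : X)
    (R C : ℝ) : Prop :=
  ∀ y ∈ Metric.ball x R, ∀ r ∈ Set.Ioo (0:ℝ) R,
    Per m (E \ Metric.ball y r) (Metric.ball x (2 * R)) ≤
      ENNReal.ofReal C * m (Metric.ball y r ∩ E) / ENNReal.ofReal r +
        Per m E (Metric.ball x (2 * R)) ∧
    Per m (E ∪ Metric.ball y r) (Metric.ball x (2 * R)) ≤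
      ENNReal.ofReal C * m (Metric.ball y r \ E) / ENNReal.ofReal r +
        Per m E (Metric.ball x (2 * R))

/-- The deformation inequalities hold for `E` at `x` with radius `R` and some constant. -/
def DeformAt [MetricSpace X] [MeasurableSpace X] (m : Measure X) (E : Set X) (x : X)
    (R : ℝ) : Prop :=
  0 < R ∧ R ≤ 1 ∧ ∃ C : ℝ, 0 ≤ C ∧ DeformIneq m E x R C

/-- `R_x(E)`: the maximal radius in `(0,1]` for which the deformation inequalities hold. -/
def deformRadius [MetricSpace X] [MeasurableSpace X] (m : Measure X) (E : Set X) (x : X) : ℝ :=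
  sSup { R : ℝ | DeformAt m E x R }

/-- `(X, d, m)` has the deformation property. -/
def DeformationProperty [MetricSpace X] [MeasurableSpace X] (m : Measure X) : Prop :=
  ∀ E : Set X, MeasurableSet E → HasLocFinPer m E → ∀ x : X, ∃ R : ℝ, DeformAt m E x R

/-- `E` is a volume-constrained minimizer of the perimeter. -/
def VolConstMin [MetricSpace X] [MeasurableSpace X] (m : Measure X) (E : Set X) : Prop :=
  MeasurableSet E ∧ HasLocFinPer m E ∧
    ∀ F K : Set X, MeasurableSet F → IsCompact K →
      m ((E ∆ F) \ K) = 0 → m (E ∩ K) = m (F ∩ K) → Per m E K ≤ Per m F K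

/-- `E` is an isoperimetric set. -/
def IsIsoperimetricSet [MetricSpace X] [MeasurableSpace X] (m : Measure X) (E : Set X) : Prop :=
  MeasurableSet E ∧ HasFinPer m E ∧ 0 < m E ∧ m E < ∞ ∧
    ∀ F : Set X, MeasurableSet F → m F = m E → Per m E Set.univ ≤ Per m F Set.univ

/-! ### The slope -/

/-- Interpolation of `f` and `g` with weight `φ`. -/
def interp (φ f g : X → ℝ) (x : X) : ℝ := φ x * f x + (1 - φ x) * g x

lemma abs_interp_sub_le {φ f g : X → ℝ} (h0 : ∀ x, 0 ≤ φ x) (h1 : ∀ x, φ x ≤ 1) (x y : X) :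
    |interp φ f g x - interp φ f g y| ≤
      |f x - f y| + |g x - g y| + |φ x - φ y| * |f y - g y| := by
  have : interp φ f g x - interp φ f g y =
      φ x * (f x - f y) + (1 - φ x) * (g x - g y) + (φ x - φ y) * (f y - g y) := by
    unfold interp; ring
  rw [this, ← abs_mul (φ x - φ y)]
  refine (abs_add_three _ _ _).trans ?_
  rw [abs_mul, abs_mul (1 - φ x), abs_of_nonneg (h0 x), abs_of_nonneg (sub_nonneg.2 (h1 x))]
  gcongr
  · exact mul_le_of_le_one_left (abs_nonneg _) (h1 x)
  · exact mul_le_of_le_one_left (abs_nonneg _) (by linarith [h0 x])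

section Slope

variable [MetricSpace X]

lemma slopeOn_mono {U V : Set X} (h : U ⊆ V) (f : X → ℝ) (x : X) :
    slopeOn U f x ≤ slopeOn V f x :=
  limsup_le_limsup_of_le (nhdsWithin_mono _ (sdiff_subset_sdiff_left h))

lemma slopeOn_congr {U V : Set X} {f g : X → ℝ} {x : X} (hU : U ∈ 𝓝 x) (hV : V ∈ 𝓝 x)
    (hfg : f =ᶠ[𝓝 x] g) : slopeOn U f x = slopeOn V g x := by
  have h1 : 𝓝[U \ {x}] x = 𝓝[V \ {x}] x := by
    rw [sdiff_eq, sdiff_eq, nhdsWithin_inter', nhdsWithin_inter', nhdsWithin_eq_nhds.2 hU,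
      nhdsWithin_eq_nhds.2 hV]
  unfold slopeOn
  rw [h1]
  refine limsup_congr ?_
  filter_upwards [nhdsWithin_le_nhds hfg] with y hy
  rw [hy, hfg.eq_of_nhds]

lemma LocLipOn.mono {U V : Set X} {f : X → ℝ} (hf : LocLipOn V f) (h : U ⊆ V) : LocLipOn U f := by
  intro x hx
  obtain ⟨r, hr, K, hK⟩ := hf x (h hx)
  exact ⟨r, hr, K, hK.mono (inter_subset_inter_right _ h)⟩

lemma LocLipOn.continuousOn {U : Set X} {f : X → ℝ} (hf : LocLipOn U f) : ContinuousOn f U := by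
  intro x hx
  obtain ⟨r, hr, K, hK⟩ := hf x hx
  have := hK.continuousOn x ⟨mem_ball_self hr, hx⟩
  exact this.mono_of_mem_nhdsWithin
    (inter_mem (mem_nhdsWithin_of_mem_nhds (ball_mem_nhds x hr)) self_mem_nhdsWithin)

lemma LocLipOn.congr {U : Set X} {f g : X → ℝ} (hf : LocLipOn U f) (h : EqOn f g U) :
    LocLipOn U g := by
  intro x hx
  obtain ⟨r, hr, K, hK⟩ := hf x hx
  refine ⟨r, hr, K, fun y hy z hz => ?_⟩
  rw [← h hy.2, ← h hz.2]
  exact hK hy hz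

lemma LocLipOn.of_local {U : Set X} {f : X → ℝ}
    (h : ∀ x ∈ U, ∃ W ∈ 𝓝 x, LocLipOn (W ∩ U) f) : LocLipOn U f := by
  intro x hx
  obtain ⟨W, hW, hf⟩ := h x hx
  obtain ⟨r, hr, K, hK⟩ := hf x ⟨mem_of_mem_nhds hW, hx⟩
  obtain ⟨s, hs, hsW⟩ := Metric.mem_nhds_iff.1 hW
  refine ⟨min r s, lt_min hr hs, K, hK.mono ?_⟩
  rintro y ⟨hy, hyU⟩
  exact ⟨ball_subset_ball (min_le_left _ _) hy, hsW (ball_subset_ball (min_le_right _ _) hy), hyU⟩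

lemma locLipOn_const (U : Set X) (c : ℝ) : LocLipOn U fun _ => c :=
  fun _ _ => ⟨1, one_pos, 0, (LipschitzWith.const c).lipschitzOnWith⟩

lemma slopeOn_interp_le {U : Set X} {φ f g : X → ℝ} {κ : NNReal} {x : X}
    (h0 : ∀ x, 0 ≤ φ x) (h1 : ∀ x, φ x ≤ 1) (hφ : LipschitzWith κ φ)
    (hf : ContinuousWithinAt f U x) (hg : ContinuousWithinAt g U x) :
    slopeOn U (interp φ f g) x ≤
      slopeOn U f x + slopeOn U g x + κ * ENNReal.ofReal |f x - g x| := by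
  rcases eq_or_ne (slopeOn U f x) ∞ with hfi | hfi
  · simp [hfi]
  rcases eq_or_ne (slopeOn U g x) ∞ with hgi | hgi
  · simp [hgi]
  refine ENNReal.le_of_forall_pos_le_add fun ε hε _ => ?_
  have hε3 : (ε : ℝ≥0∞) / 3 ≠ 0 := by simp [hε.ne']
  have e1 := eventually_lt_of_limsup_lt (ENNReal.lt_add_right hfi hε3)
  have e2 := eventually_lt_of_limsup_lt (ENNReal.lt_add_right hgi hε3)
  have hc : Tendsto (fun y => (κ : ℝ≥0∞) * ENNReal.ofReal |f y - g y|) (𝓝[U \ {x}] x)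
      (𝓝 (κ * ENNReal.ofReal |f x - g x|)) := by
    refine ENNReal.Tendsto.const_mul (ENNReal.tendsto_ofReal ?_) (Or.inr ENNReal.coe_ne_top)
    exact ((hf.mono sdiff_subset).sub (hg.mono sdiff_subset)).abs
  have e3 := hc.eventually_lt_const (ENNReal.lt_add_right (by finiteness) hε3)
  refine limsup_le_of_le (by isBoundedDefault) ?_
  filter_upwards [e1, e2, e3, self_mem_nhdsWithin] with y h1' h2' h3' hy
  have hd : 0 < dist x y := dist_pos.2 (fun h => hy.2 h.symm)
  have hφd : |φ x - φ y| / dist x y ≤ κ := by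
    rw [div_le_iff₀ hd]; exact hφ.dist_le_mul x y
  have key : |interp φ f g x - interp φ f g y| / dist x y ≤
      |f x - f y| / dist x y + |g x - g y| / dist x y + κ * |f y - g y| := by
    calc _ ≤ (|f x - f y| + |g x - g y| + |φ x - φ y| * |f y - g y|) / dist x y := by
          gcongr; exact abs_interp_sub_le h0 h1 x y
      _ = |f x - f y| / dist x y + |g x - g y| / dist x y
          + |φ x - φ y| / dist x y * |f y - g y| := by ring
      _ ≤ _ := by gcongr
  calc _ ≤ ENNReal.ofReal (|f x - f y| / dist x y) + ENNReal.ofReal (|g x - g y| / dist x y)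
        + κ * ENNReal.ofReal |f y - g y| := by
        refine (ENNReal.ofReal_le_ofReal key).trans (le_of_eq ?_)
        rw [ENNReal.ofReal_add (by positivity) (by positivity),
          ENNReal.ofReal_add (by positivity) (by positivity),
          ENNReal.ofReal_mul (by positivity), ENNReal.ofReal_coe_nnreal]
    _ ≤ (slopeOn U f x + ε / 3) + (slopeOn U g x + ε / 3)
        + (κ * ENNReal.ofReal |f x - g x| + ε / 3) := by
        gcongr
        exacts [h1'.le, h2'.le]
    _ = _ := by
        have : (ε : ℝ≥0∞) = ε / 3 + ε / 3 + ε / 3 := (ENNReal.add_thirds _).symm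
        conv_rhs => rw [this]
        ring

lemma LocLipOn.interp {U : Set X} {φ f g : X → ℝ} {κ : NNReal}
    (h0 : ∀ x, 0 ≤ φ x) (h1 : ∀ x, φ x ≤ 1) (hφ : LipschitzWith κ φ)
    (hf : LocLipOn U f) (hg : LocLipOn U g) : LocLipOn U (interp φ f g) := by
  intro x hx
  obtain ⟨r, hr, K, hK⟩ := hf x hx
  obtain ⟨s, hs, L, hL⟩ := hg x hx
  set M : NNReal := ⟨|f x - g x| + K * r + L * s, by positivity⟩
  refine ⟨min r s, lt_min hr hs, K + L + κ * M, LipschitzOnWith.of_dist_le_mul ?_⟩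
  rintro y ⟨hy, hyU⟩ z ⟨hz, hzU⟩
  have hyr := ball_subset_ball (min_le_left r s) hy
  have hys := ball_subset_ball (min_le_right r s) hy
  have hzr := ball_subset_ball (min_le_left r s) hz
  have hzs := ball_subset_ball (min_le_right r s) hz
  have a1 := hK.dist_le_mul y ⟨hyr, hyU⟩ z ⟨hzr, hzU⟩
  have a2 := hL.dist_le_mul y ⟨hys, hyU⟩ z ⟨hzs, hzU⟩
  have a3 := hφ.dist_le_mul y z
  have b1 := hK.dist_le_mul z ⟨hzr, hzU⟩ x ⟨mem_ball_self hr, hx⟩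
  have b2 := hL.dist_le_mul z ⟨hzs, hzU⟩ x ⟨mem_ball_self hs, hx⟩
  rw [Real.dist_eq] at *
  have hM : |f z - g z| ≤ M := by
    have c1 : (K : ℝ) * dist z x ≤ K * r := by gcongr; exact (mem_ball.1 hzr).le
    have c2 : (L : ℝ) * dist z x ≤ L * s := by gcongr; exact (mem_ball.1 hzs).le
    have c3 : f z - g z = (f x - g x) + (f z - f x) - (g z - g x) := by ring
    change _ ≤ |f x - g x| + K * r + L * s
    rw [c3]
    have := abs_sub ((f x - g x) + (f z - f x)) (g z - g x)
    have := abs_add_le (f x - g x) (f z - f x)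
    linarith
  refine (abs_interp_sub_le h0 h1 y z).trans ?_
  push_cast
  calc _ ≤ K * dist y z + L * dist y z + (κ * dist y z) * M := by gcongr
    _ = _ := by ring

end Slope

section SlopeMeasurable

variable [MetricSpace X] [MeasurableSpace X] [BorelSpace X]

lemma aemeasurable_slopeOn {U : Set X} (hU : IsOpen U) {f : X → ℝ} (hf : ContinuousOn f U)
    (m : Measure X) : AEMeasurable (slopeOn U f) (m.restrict U) := by
  classical
  let q : X → X → ℝ≥0∞ := fun y x => ENNReal.ofReal (|f x - f y| / dist x y)
  let O : ℕ → X → Set X := fun n y => (U ∩ ball y (1 / ((n : ℝ) + 1))) \ {y}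
  let G : ℕ → X → ℝ≥0∞ := fun n x => ⨆ y ∈ U, (O n y).indicator (q y) x
  have hO : ∀ n y, IsOpen (O n y) := fun n y =>
    (hU.inter isOpen_ball).sdiff isClosed_singleton
  have hq : ∀ n, ∀ y, ContinuousOn (q y) (O n y) := by
    intro n y
    refine ENNReal.continuous_ofReal.comp_continuousOn (ContinuousOn.div ?_ ?_ ?_)
    · exact ((hf.mono (fun x hx => hx.1.1)).sub continuousOn_const).abs
    · fun_prop
    · intro x hx; exact dist_ne_zero.2 hx.2
  have hG : ∀ n, Measurable (G n) := by
    intro n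
    refine LowerSemicontinuous.measurable ?_
    refine lowerSemicontinuous_biSup fun y _ => ?_
    rw [lowerSemicontinuous_iff_isOpen_preimage]
    intro c
    have : (O n y).indicator (q y) ⁻¹' Ioi c = O n y ∩ q y ⁻¹' Ioi c := by
      ext x
      by_cases hx : x ∈ O n y <;> simp [hx]
    rw [this]
    exact (hq n y).isOpen_inter_preimage (hO n y) isOpen_Ioi
  refine ⟨fun x => ⨅ n, G n x, Measurable.iInf hG, ?_⟩
  filter_upwards [ae_restrict_mem hU.measurableSet] with x hx
  unfold slopeOn
  rw [(nhdsWithin_hasBasis Metric.nhds_basis_ball_inv_nat_succ (U \ {x})).limsup_eq_iInf_iSup]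
  simp only [iInf_pos]
  refine iInf_congr fun n => ?_
  apply le_antisymm
  · refine iSup₂_le fun y hy => ?_
    refine le_iSup₂_of_le y hy.2.1 ?_
    rw [indicator_of_mem]
    exact ⟨⟨hx, mem_ball_comm.1 hy.1⟩, fun h => hy.2.2 h.symm⟩
  · refine iSup₂_le fun y hy => ?_
    by_cases h : x ∈ O n y
    · rw [indicator_of_mem h]
      exact le_iSup₂_of_le y ⟨mem_ball_comm.1 h.1.2, hy, fun h' => h.2 h'.symm⟩ le_rfl
    · rw [indicator_of_notMem h]; exact zero_le

end SlopeMeasurable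

lemma ENNReal.add_liminf_le {ι : Type*} {l : Filter ι} (u v : ι → ℝ≥0∞) :
    liminf u l + liminf v l ≤ liminf (fun i => u i + v i) l := by
  rcases eq_or_ne (liminf u l) 0 with h0 | h0
  · rw [h0, zero_add]
    exact liminf_le_liminf (Eventually.of_forall fun i => le_add_self)
  rcases eq_or_ne (liminf v l) 0 with h0' | h0'
  · rw [h0', add_zero]
    exact liminf_le_liminf (Eventually.of_forall fun i => le_self_add)
  refine le_of_forall_lt fun c hc => ?_
  obtain ⟨a, ha, b, hb, hab⟩ := ENNReal.exists_lt_add_of_lt_add hc h0 h0'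
  refine hab.trans_le (le_liminf_of_le (by isBoundedDefault) ?_)
  filter_upwards [eventually_lt_of_lt_liminf ha, eventually_lt_of_lt_liminf hb] with i h1 h2
  exact add_le_add h1.le h2.le

section Slope

variable [MetricSpace X]

lemma slopeOn_const (U : Set X) (c : ℝ) (x : X) : slopeOn U (fun _ => c) x = 0 := by
  unfold slopeOn
  simp only [sub_self, abs_zero, zero_div, ENNReal.ofReal_zero]
  exact le_antisymm (limsup_le_of_le (by isBoundedDefault) (by simp)) zero_le

end Slope

/-! ### Basic properties of the perimeter -/

section Perimeter

variable [MetricSpace X] [MeasurableSpace X] {m : Measure X} {E F : Set X}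

/-- The characteristic function of `E`. -/
abbrev charFn (E : Set X) : X → ℝ := E.indicator fun _ => 1

lemma TendstoL1loc.mono {U V : Set X} {f : ℕ → X → ℝ} {g : X → ℝ} (h : TendstoL1loc m V f g)
    (hUV : U ⊆ V) : TendstoL1loc m U f g :=
  fun K hK hKc => h K (hK.trans hUV) hKc

lemma TendstoL1loc.comp {U : Set X} {f : ℕ → X → ℝ} {g : X → ℝ} (h : TendstoL1loc m U f g)
    {k : ℕ → ℕ} (hk : Tendsto k atTop atTop) : TendstoL1loc m U (fun n => f (k n)) g :=
  fun K hK hKc => (h K hK hKc).comp hk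

lemma per_mono {B B' : Set X} (h : B ⊆ B') : Per m E B ≤ Per m E B' := by
  unfold Per totVar
  exact iInf_mono fun Ω => iInf_mono fun _ => iInf_mono' fun h' => ⟨h.trans h', le_rfl⟩

lemma per_le_liminf {U : Set X} (hU : IsOpen U) {f : ℕ → X → ℝ} (hf : ∀ n, LocLipOn U (f n))
    (ht : TendstoL1loc m U f (charFn E)) :
    Per m E U ≤ liminf (fun n => ∫⁻ x in U, slopeOn U (f n) x ∂m) atTop :=
  iInf₂_le_of_le U hU <| iInf_le_of_le Subset.rfl <| iInf₂_le_of_le f hf <| iInf_le_of_le ht le_rfl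

lemma exists_isOpen_per_lt {B : Set X} {c : ℝ≥0∞} (h : Per m E B < c) :
    ∃ U, IsOpen U ∧ B ⊆ U ∧ Per m E U < c := by
  unfold Per totVar at h
  simp only [iInf_lt_iff] at h
  obtain ⟨U, hU, hB, f, hf, ht, hc⟩ := h
  exact ⟨U, hU, hB, (per_le_liminf hU hf ht).trans_lt hc⟩

lemma exists_seq_of_per_lt {U : Set X} {c : ℝ≥0∞} (h : Per m E U < c) :
    ∃ f : ℕ → X → ℝ, (∀ n, LocLipOn U (f n)) ∧ TendstoL1loc m U f (charFn E) ∧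
      ∀ n, ∫⁻ x in U, slopeOn U (f n) x ∂m < c := by
  unfold Per totVar at h
  simp only [iInf_lt_iff] at h
  obtain ⟨V, hV, hUV, f, hf, ht, hc⟩ := h
  obtain ⟨k, hk, hkc⟩ := extraction_of_frequently_atTop
    (frequently_lt_of_liminf_lt (by isBoundedDefault) hc)
  refine ⟨fun n => f (k n), fun n => (hf _).mono hUV, (ht.mono hUV).comp hk.tendsto_atTop,
    fun n => lt_of_le_of_lt ?_ (hkc n)⟩
  exact (lintegral_mono fun x => slopeOn_mono hUV _ x).trans (lintegral_mono_set hUV)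

lemma per_congr [OpensMeasurableSpace X] {U : Set X} (hU : IsOpen U) (h : m ((E ∆ F) ∩ U) = 0) :
    Per m E U = Per m F U := by
  have key : ∀ {E F : Set X}, m ((E ∆ F) ∩ U) = 0 → Per m E U ≤ Per m F U := by
    intro E F h
    refine le_of_forall_gt_imp_ge_of_dense fun c hc => ?_
    obtain ⟨f, hf, ht, hfc⟩ := exists_seq_of_per_lt hc
    refine (per_le_liminf hU hf (E := E) ?_).trans
      (liminf_le_of_frequently_le' (Frequently.of_forall fun n => (hfc n).le))
    intro K hK hKc
    refine (ht K hK hKc).congr fun n => lintegral_congr_ae ?_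
    have h0 : ∀ᵐ x ∂m.restrict K, x ∉ E ∆ F := by
      rw [ae_iff]
      simp only [not_not, ofPred_mem_eq]
      rw [Measure.restrict_apply' hKc.measurableSet]
      exact measure_mono_null (inter_subset_inter_right _ hK) h
    filter_upwards [h0] with x hx
    have : x ∈ E ↔ x ∈ F := by
      rw [mem_symmDiff] at hx; tauto
    have : charFn F x = charFn E x := by by_cases hxF : x ∈ F <;> simp [charFn, this, hxF]
    rw [← this]
  exact le_antisymm (key h) (key (by rwa [symmDiff_comm]))

lemma per_compl_le (E B : Set X) : Per m Eᶜ B ≤ Per m E B := by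
  refine le_of_forall_gt_imp_ge_of_dense fun c hc => ?_
  obtain ⟨U, hU, hB, hc⟩ := exists_isOpen_per_lt hc
  obtain ⟨f, hf, ht, hfc⟩ := exists_seq_of_per_lt hc
  refine (per_mono hB).trans <| (per_le_liminf hU (f := fun n x => 1 - f n x) ?_ ?_).trans
      (liminf_le_of_frequently_le' (Frequently.of_forall fun n => (?_ : _ ≤ c)))
  · intro n x hx
    obtain ⟨r, hr, K, hK⟩ := hf n x hx
    refine ⟨r, hr, K, fun y hy z hz => ?_⟩
    have := hK hy hz
    have h' : edist (1 - f n y) (1 - f n z) = edist (f n y) (f n z) := by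
      rw [edist_dist, edist_dist, dist_sub_left]
    exact h'.trans_le this
  · intro K hK hKc
    refine (ht K hK hKc).congr fun n => lintegral_congr fun x => ?_
    congr 1
    by_cases hx : x ∈ E <;> simp [hx, abs_sub_comm]
  · refine le_trans (le_of_eq ?_) (hfc n).le
    refine lintegral_congr fun x => ?_
    unfold slopeOn
    refine limsup_congr (Eventually.of_forall fun y => ?_)
    have h' : |1 - f n x - (1 - f n y)| = |f n x - f n y| := by
      rw [abs_sub_comm]; congr 1; ring
    simp only [h']

lemma per_compl (E B : Set X) : Per m Eᶜ B = Per m E B :=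
  le_antisymm (per_compl_le E B) (by simpa using per_compl_le (m := m) Eᶜ B)

end Perimeter

section Superadditivity

variable [MetricSpace X] [MeasurableSpace X] [BorelSpace X] {m : Measure X} {E F : Set X}

lemma sum_per_le_mul {ι : Type*} {S : Finset ι} {U : ι → Set X} {V : Set X} {N : ℝ≥0∞}
    (hN0 : N ≠ 0) (hN : N ≠ ∞) (hU : ∀ i ∈ S, IsOpen (U i)) (hUV : ∀ i ∈ S, U i ⊆ V)
    (hov : ∀ x ∈ V, ∑ i ∈ S, (U i).indicator (fun _ => (1 : ℝ≥0∞)) x ≤ N) (hV : IsOpen V) :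
    ∑ i ∈ S, Per m E (U i) ≤ N * Per m E V := by
  by_contra! hcon
  have hcon' : Per m E V < (∑ i ∈ S, Per m E (U i)) / N := by
    rw [ENNReal.lt_div_iff_mul_lt (Or.inl hN0) (Or.inl hN), mul_comm]
    exact hcon
  obtain ⟨c, hc1, hc2⟩ := exists_between hcon'
  have hc2' : N * c < ∑ i ∈ S, Per m E (U i) := by
    rwa [ENNReal.lt_div_iff_mul_lt (Or.inl hN0) (Or.inl hN),
      mul_comm] at hc2
  obtain ⟨f, hf, ht, hfc⟩ := exists_seq_of_per_lt hc1
  refine absurd hc2' (not_lt.2 ?_)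
  have hsum : ∀ T : Finset ι, T ⊆ S → ∑ i ∈ T, Per m E (U i) ≤
      liminf (fun n => ∑ i ∈ T, ∫⁻ x in U i, slopeOn (U i) (f n) x ∂m) atTop := by
    classical
    intro T
    induction T using Finset.induction_on with
    | empty => simp
    | insert i T hi ih =>
      intro hT
      simp only [Finset.sum_insert hi]
      have hiS := hT (Finset.mem_insert_self i T)
      refine (add_le_add (per_le_liminf (hU i hiS) (fun n => (hf n).mono (hUV i hiS))
        (ht.mono (hUV i hiS))) (ih ((Finset.subset_insert i T).trans hT))).trans ?_
      exact ENNReal.add_liminf_le _ _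
  refine (hsum S Finset.Subset.rfl).trans
    (liminf_le_of_frequently_le' (Frequently.of_forall fun n => ?_))
  have hmeas := aemeasurable_slopeOn hV (hf n).continuousOn m
  calc ∑ i ∈ S, ∫⁻ x in U i, slopeOn (U i) (f n) x ∂m
      ≤ ∑ i ∈ S, ∫⁻ x in V, (U i).indicator (slopeOn V (f n)) x ∂m := by
        refine Finset.sum_le_sum fun i hi => ?_
        rw [lintegral_indicator (hU i hi).measurableSet, Measure.restrict_restrict
          (hU i hi).measurableSet, inter_eq_left.2 (hUV i hi)]
        exact lintegral_mono fun x => slopeOn_mono (hUV i hi) _ x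
    _ = ∫⁻ x in V, ∑ i ∈ S, (U i).indicator (slopeOn V (f n)) x ∂m := by
        rw [lintegral_finsetSum' _ fun i hi => hmeas.indicator (hU i hi).measurableSet]
    _ ≤ ∫⁻ x in V, N * slopeOn V (f n) x ∂m := by
        refine setLIntegral_mono' hV.measurableSet fun x hx => ?_
        refine le_trans (le_of_eq ?_) (mul_le_mul_left (hov x hx) _)
        rw [Finset.sum_mul]
        refine Finset.sum_congr rfl fun i _ => ?_
        by_cases h : x ∈ U i <;> simp [h]
    _ = N * ∫⁻ x in V, slopeOn V (f n) x ∂m := lintegral_const_mul'' _ hmeas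
    _ ≤ N * c := by gcongr; exact (hfc n).le

lemma per_add_le {U₁ U₂ V : Set X} (h1 : IsOpen U₁) (h2 : IsOpen U₂) (hV : IsOpen V)
    (hd : Disjoint U₁ U₂) (h1V : U₁ ⊆ V) (h2V : U₂ ⊆ V) :
    Per m E U₁ + Per m E U₂ ≤ Per m E V := by
  have := sum_per_le_mul (m := m) (E := E) (S := Finset.univ) (U := fun b : Bool => cond b U₁ U₂)
    (V := V) (N := 1) one_ne_zero (by simp) (by simp [h1, h2]) (by simp [h1V, h2V]) ?_ hV
  · simpa using this
  · intro x _
    simp only [Fintype.sum_bool, cond_true, cond_false]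
    by_cases hx : x ∈ U₁
    · simp [hx, disjoint_left.1 hd hx]
    · rw [indicator_of_notMem hx, zero_add]
      exact indicator_le_self' (fun _ _ => zero_le) x |>.trans le_rfl

end Superadditivity

/-! ### Gluing -/

section Cutoff

variable [MetricSpace X] {A : Set X} {a b : ℝ}

/-- A Lipschitz cutoff, equal to `1` where `infDist · A ≤ a` and to `0` where `b ≤ infDist · A`. -/
def cutoff (A : Set X) (a b : ℝ) (p : X) : ℝ := max 0 (min 1 ((b - infDist p A) / (b - a)))

lemma cutoff_nonneg (p : X) : 0 ≤ cutoff A a b p := le_max_left _ _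

lemma cutoff_le_one (p : X) : cutoff A a b p ≤ 1 := max_le zero_le_one (min_le_left _ _)

lemma cutoff_eq_one (hab : a < b) {p : X} (hp : infDist p A ≤ a) : cutoff A a b p = 1 := by
  have : 1 ≤ (b - infDist p A) / (b - a) := by
    rw [le_div_iff₀ (by linarith)]; linarith
  simp [cutoff, this]

lemma cutoff_eq_zero (hab : a < b) {p : X} (hp : b ≤ infDist p A) : cutoff A a b p = 0 := by
  have : (b - infDist p A) / (b - a) ≤ 0 :=
    div_nonpos_of_nonpos_of_nonneg (by linarith) (by linarith)
  exact max_eq_left ((min_le_right _ _).trans this)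

lemma lipschitzWith_cutoff (A : Set X) (hab : a < b) :
    LipschitzWith (Real.toNNReal (1 / (b - a))) (cutoff A a b) := by
  have h : LipschitzWith (Real.toNNReal (1 / (b - a)))
      (fun p => (b - infDist p A) / (b - a)) := by
    refine LipschitzWith.of_dist_le_mul fun p q => ?_
    have hba : 0 < b - a := by linarith
    rw [Real.coe_toNNReal _ (by positivity), Real.dist_eq, ← sub_div,
      abs_div, abs_of_pos hba, div_mul_eq_mul_div, one_mul]
    gcongr
    have := (lipschitz_infDist_pt A).dist_le_mul p q
    rw [Real.dist_eq] at this
    rw [show b - infDist p A - (b - infDist q A) = -(infDist p A - infDist q A) by ring, abs_neg]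
    simpa using this
  exact (h.const_min 1).const_max 0

lemma locLipOn_interp_cutoff {U V W : Set X} {f g : X → ℝ} (hab : a < b)
    (hV : IsOpen V) (hW : IsOpen W)
    (hUV : ∀ p ∈ U, infDist p A ≤ b → p ∈ V) (hUW : ∀ p ∈ U, a ≤ infDist p A → p ∈ W)
    (hf : LocLipOn V f) (hg : LocLipOn W g) : LocLipOn U (interp (cutoff A a b) f g) := by
  have hc : Continuous fun p => infDist p A := continuous_infDist_pt A
  refine LocLipOn.of_local fun x hx => ?_
  rcases lt_or_ge (infDist x A) a with h1 | h1
  · refine ⟨V ∩ {p | infDist p A < a}, inter_mem (hV.mem_nhds (hUV x hx (by linarith)))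
      ((isOpen_lt hc continuous_const).mem_nhds h1), ?_⟩
    refine (hf.mono fun p hp => hp.1.1).congr fun p hp => ?_
    simp [interp, cutoff_eq_one hab (le_of_lt hp.1.2)]
  rcases lt_or_ge b (infDist x A) with h2 | h2
  · refine ⟨W ∩ {p | b < infDist p A}, inter_mem (hW.mem_nhds (hUW x hx (by linarith)))
      ((isOpen_lt continuous_const hc).mem_nhds h2), ?_⟩
    refine (hg.mono fun p hp => hp.1.1).congr fun p hp => ?_
    simp [interp, cutoff_eq_zero hab (le_of_lt hp.1.2)]
  · refine ⟨V ∩ W, inter_mem (hV.mem_nhds (hUV x hx h2)) (hW.mem_nhds (hUW x hx h1)), ?_⟩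
    exact LocLipOn.interp cutoff_nonneg cutoff_le_one (lipschitzWith_cutoff A hab)
      (hf.mono fun p hp => hp.1.1) (hg.mono fun p hp => hp.1.2)

lemma slopeOn_interp_cutoff_le {U V W : Set X} {f g : X → ℝ} (hab : a < b) (hU : IsOpen U)
    (hV : IsOpen V) (hW : IsOpen W)
    (hUV : ∀ p ∈ U, infDist p A ≤ b → p ∈ V) (hUW : ∀ p ∈ U, a ≤ infDist p A → p ∈ W)
    (hf : ContinuousOn f V) (hg : ContinuousOn g W) {x : X} (hx : x ∈ U) :
    slopeOn U (interp (cutoff A a b) f g) x ≤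
      {p | infDist p A ≤ b}.indicator (slopeOn V f) x +
      {p | a ≤ infDist p A}.indicator (slopeOn W g) x +
      Real.toNNReal (1 / (b - a)) * {p | a ≤ infDist p A ∧ infDist p A ≤ b}.indicator
        (fun p => ENNReal.ofReal |f p - g p|) x := by
  have hc : Continuous fun p => infDist p A := continuous_infDist_pt A
  rcases lt_or_ge (infDist x A) a with h1 | h1
  · have h2 : infDist x A ≤ b := by linarith
    rw [slopeOn_congr (hU.mem_nhds hx) (hV.mem_nhds (hUV x hx h2)) (g := f)]
    · rw [indicator_of_mem (by exact h2), add_assoc]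
      exact le_self_add
    · filter_upwards [(isOpen_lt hc continuous_const).mem_nhds h1] with p hp
      simp [interp, cutoff_eq_one hab (le_of_lt hp)]
  rcases lt_or_ge b (infDist x A) with h2 | h2
  · have h2 : a ≤ infDist x A := by linarith
    rw [slopeOn_congr (hU.mem_nhds hx) (hW.mem_nhds (hUW x hx h2)) (g := g)]
    · rw [indicator_of_mem (s := {p | a ≤ infDist p A}) (by exact h2), add_right_comm]
      exact le_add_self
    · filter_upwards [(isOpen_lt continuous_const hc).mem_nhds (by assumption)] with p hp
      simp [interp, cutoff_eq_zero hab (le_of_lt hp)]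
  · have hxV := hV.mem_nhds (hUV x hx h2)
    have hxW := hW.mem_nhds (hUW x hx h1)
    rw [indicator_of_mem (s := {p | infDist p A ≤ b}) (by exact h2),
      indicator_of_mem (s := {p | a ≤ infDist p A}) (by exact h1),
      indicator_of_mem (s := {p | a ≤ infDist p A ∧ infDist p A ≤ b}) (by exact ⟨h1, h2⟩)]
    refine (slopeOn_interp_le cutoff_nonneg cutoff_le_one (lipschitzWith_cutoff A hab)
      (hf.continuousAt hxV).continuousWithinAt (hg.continuousAt hxW).continuousWithinAt).trans ?_
    rw [slopeOn_congr (hU.mem_nhds hx) hxV (EventuallyEq.refl _ f),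
      slopeOn_congr (hU.mem_nhds hx) hxW (EventuallyEq.refl _ g)]

lemma ofReal_abs_interp_cutoff_sub_le (hab : a < b) (f g χ : X → ℝ) (x : X) :
    ENNReal.ofReal |interp (cutoff A a b) f g x - χ x| ≤
      {p | infDist p A ≤ b}.indicator (fun p => ENNReal.ofReal |f p - χ p|) x +
      {p | a ≤ infDist p A}.indicator (fun p => ENNReal.ofReal |g p - χ p|) x := by
  rcases lt_or_ge (infDist x A) a with h1 | h1
  · have h2 : infDist x A ≤ b := by linarith
    rw [indicator_of_mem (by exact h2)]
    simp [interp, cutoff_eq_one hab h1.le]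
  rw [indicator_of_mem (s := {p | a ≤ infDist p A}) (by exact h1)]
  rcases lt_or_ge b (infDist x A) with h2 | h2
  · simp [interp, cutoff_eq_zero hab h2.le]
  · rw [indicator_of_mem (by exact h2), ← ENNReal.ofReal_add (abs_nonneg _) (abs_nonneg _)]
    refine ENNReal.ofReal_le_ofReal ?_
    have e : interp (cutoff A a b) f g x - χ x =
        cutoff A a b x * (f x - χ x) + (1 - cutoff A a b x) * (g x - χ x) := by
      unfold interp; ring
    have h0 := cutoff_nonneg (A := A) (a := a) (b := b) x
    have h1 := cutoff_le_one (A := A) (a := a) (b := b) x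
    rw [e]
    refine (abs_add_le _ _).trans ?_
    rw [abs_mul, abs_mul, abs_of_nonneg h0, abs_of_nonneg (sub_nonneg.2 h1)]
    gcongr
    · exact mul_le_of_le_one_left (abs_nonneg _) h1
    · exact mul_le_of_le_one_left (abs_nonneg _) (by linarith)

end Cutoff

section Measurability

variable [MeasurableSpace X] {m : Measure X} {E : Set X}

lemma measurable_charFn (hE : MeasurableSet E) : Measurable (charFn E) :=
  measurable_const.indicator hE

lemma lintegral_indicator_slopeOn_le [MetricSpace X] {U V S : Set X} {f : X → ℝ}
    (hS : MeasurableSet S) (hSV : S ∩ U ⊆ V) :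
    ∫⁻ x in U, S.indicator (slopeOn V f) x ∂m ≤ ∫⁻ x in V, slopeOn V f x ∂m := by
  rw [lintegral_indicator hS, Measure.restrict_restrict hS]
  exact lintegral_mono_set hSV

end Measurability

section Gluing

variable [MetricSpace X] [MeasurableSpace X] [BorelSpace X] {m : Measure X} {E F : Set X}
  {A : Set X} {a b : ℝ}

lemma aemeasurable_indicator_slopeOn {U V S : Set X} {f : X → ℝ} (hV : IsOpen V)
    (hf : ContinuousOn f V) (hS : MeasurableSet S) (hSV : S ∩ U ⊆ V) :
    AEMeasurable (S.indicator (slopeOn V f)) (m.restrict U) := by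
  rw [aemeasurable_indicator_iff hS, Measure.restrict_restrict hS]
  exact (aemeasurable_slopeOn hV hf m).mono_measure (Measure.restrict_mono hSV le_rfl)

lemma lintegral_slopeOn_interp_cutoff_le {U V W : Set X} {f g : X → ℝ} (hab : a < b)
    (hU : IsOpen U) (hV : IsOpen V) (hW : IsOpen W)
    (hUV : ∀ p ∈ U, infDist p A ≤ b → p ∈ V) (hUW : ∀ p ∈ U, a ≤ infDist p A → p ∈ W)
    (hf : ContinuousOn f V) (hg : ContinuousOn g W) :
    ∫⁻ x in U, slopeOn U (interp (cutoff A a b) f g) x ∂m ≤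
      ∫⁻ x in U, {p | infDist p A ≤ b}.indicator (slopeOn V f) x ∂m +
      ∫⁻ x in U, {p | a ≤ infDist p A}.indicator (slopeOn W g) x ∂m +
      Real.toNNReal (1 / (b - a)) * ∫⁻ x in U ∩ {p | a ≤ infDist p A ∧ infDist p A ≤ b},
        ENNReal.ofReal |f x - g x| ∂m := by
  have hc : Continuous fun p => infDist p A := continuous_infDist_pt A
  have hS1 : MeasurableSet {p | infDist p A ≤ b} :=
    (isClosed_le hc continuous_const).measurableSet
  have hS2 : MeasurableSet {p | a ≤ infDist p A} :=
    (isClosed_le continuous_const hc).measurableSet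
  have hS3 : MeasurableSet {p | a ≤ infDist p A ∧ infDist p A ≤ b} := hS2.inter hS1
  have hm1 : AEMeasurable ({p | infDist p A ≤ b}.indicator (slopeOn V f)) (m.restrict U) :=
    aemeasurable_indicator_slopeOn hV hf hS1 fun p hp => hUV p hp.2 hp.1
  have hm2 : AEMeasurable ({p | a ≤ infDist p A}.indicator (slopeOn W g)) (m.restrict U) :=
    aemeasurable_indicator_slopeOn hW hg hS2 fun p hp => hUW p hp.2 hp.1
  refine (setLIntegral_mono' hU.measurableSet fun x hx =>
    slopeOn_interp_cutoff_le hab hU hV hW hUV hUW hf hg hx).trans ?_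
  rw [lintegral_add_left' (hm1.add hm2 : AEMeasurable (fun x => _ + _) _), lintegral_add_left' hm1,
    lintegral_const_mul' _ _ ENNReal.coe_ne_top, lintegral_indicator hS3,
    Measure.restrict_restrict hS3, inter_comm U]

lemma aemeasurable_ofReal_abs_sub {K : Set X} {f g : X → ℝ} (hK : MeasurableSet K)
    (hf : ContinuousOn f K) (hg : Measurable g) :
    AEMeasurable (fun x => ENNReal.ofReal |f x - g x|) (m.restrict K) :=
  ((hf.aemeasurable hK).sub hg.aemeasurable).norm.ennreal_ofReal

/-- Gluing: the perimeter is subadditive on open sets overlapping in a thick collar. -/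
lemma per_glue {U V W K : Set X} (hE : MeasurableSet E) (hab : a < b)
    (hU : IsOpen U) (hV : IsOpen V) (hW : IsOpen W)
    (hUV : ∀ p ∈ U, infDist p A ≤ b → p ∈ V) (hUW : ∀ p ∈ U, a ≤ infDist p A → p ∈ W)
    (hK : IsCompact K) (hKV : K ⊆ V) (hKW : K ⊆ W)
    (hUK : ∀ p ∈ U, a ≤ infDist p A → infDist p A ≤ b → p ∈ K) :
    Per m E U ≤ Per m E V + Per m E W := by
  have hc : Continuous fun p => infDist p A := continuous_infDist_pt A
  have hC1 : IsClosed {p | infDist p A ≤ b} := isClosed_le hc continuous_const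
  have hC2 : IsClosed {p | a ≤ infDist p A} := isClosed_le continuous_const hc
  rcases eq_or_ne (Per m E V) ∞ with hVi | hVi
  · simp [hVi]
  rcases eq_or_ne (Per m E W) ∞ with hWi | hWi
  · simp [hWi]
  refine ENNReal.le_of_forall_pos_le_add fun ε hε _ => ?_
  have hε' : (ε : ℝ≥0∞) / 2 ≠ 0 := by simp [hε.ne']
  obtain ⟨f, hf, hft, hfc⟩ := exists_seq_of_per_lt (ENNReal.lt_add_right hVi hε')
  obtain ⟨g, hg, hgt, hgc⟩ := exists_seq_of_per_lt (ENNReal.lt_add_right hWi hε')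
  have hlim : Tendsto (fun n => (Real.toNNReal (1 / (b - a)) : ℝ≥0∞) *
      (∫⁻ x in K, ENNReal.ofReal |f n x - charFn E x| ∂m +
        ∫⁻ x in K, ENNReal.ofReal |g n x - charFn E x| ∂m)) atTop (𝓝 0) := by
    have := ENNReal.Tendsto.const_mul (a := (Real.toNNReal (1 / (b - a)) : ℝ≥0∞))
      ((hft K hKV hK).add (hgt K hKW hK)) (Or.inr ENNReal.coe_ne_top)
    simpa using this
  have hconv : TendstoL1loc m U (fun n => interp (cutoff A a b) (f n) (g n)) (charFn E) := by
    intro L hL hLc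
    have h1 := hft (L ∩ {p | infDist p A ≤ b}) (fun p hp => hUV p (hL hp.1) hp.2)
      (hLc.inter_right hC1)
    have h2 := hgt (L ∩ {p | a ≤ infDist p A}) (fun p hp => hUW p (hL hp.1) hp.2)
      (hLc.inter_right hC2)
    have h3 := h1.add h2
    rw [add_zero] at h3
    refine tendsto_of_tendsto_of_tendsto_of_le_of_le tendsto_const_nhds h3
      (fun _ => zero_le) fun n => ?_
    refine (lintegral_mono fun x => ofReal_abs_interp_cutoff_sub_le hab (f n) (g n) _ x).trans ?_
    rw [lintegral_add_left', lintegral_indicator hC1.measurableSet,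
      lintegral_indicator hC2.measurableSet, Measure.restrict_restrict hC1.measurableSet,
      Measure.restrict_restrict hC2.measurableSet, inter_comm L, inter_comm L]
    rw [aemeasurable_indicator_iff hC1.measurableSet,
      Measure.restrict_restrict hC1.measurableSet]
    exact aemeasurable_ofReal_abs_sub (hC1.measurableSet.inter hLc.measurableSet)
      ((hf n).continuousOn.mono fun p hp => hUV p (hL hp.2) hp.1) (measurable_charFn hE)
  have hbound : ∀ n, ∫⁻ x in U, slopeOn U (interp (cutoff A a b) (f n) (g n)) x ∂m ≤
      (Per m E V + Per m E W + ε) + (Real.toNNReal (1 / (b - a)) : ℝ≥0∞) *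
      (∫⁻ x in K, ENNReal.ofReal |f n x - charFn E x| ∂m +
        ∫⁻ x in K, ENNReal.ofReal |g n x - charFn E x| ∂m) := by
    intro n
    refine (lintegral_slopeOn_interp_cutoff_le hab hU hV hW hUV hUW (hf n).continuousOn
      (hg n).continuousOn).trans ?_
    gcongr ?_ + _ * ?_
    · refine (add_le_add ((lintegral_indicator_slopeOn_le hC1.measurableSet
        fun p hp => hUV p hp.2 hp.1).trans (hfc n).le) ((lintegral_indicator_slopeOn_le
        hC2.measurableSet fun p hp => hUW p hp.2 hp.1).trans (hgc n).le)).trans ?_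
      rw [add_add_add_comm, ENNReal.add_halves]
    · rw [← lintegral_add_left' (aemeasurable_ofReal_abs_sub hK.measurableSet
        ((hf n).continuousOn.mono hKV) (measurable_charFn hE))]
      refine (lintegral_mono_set fun p hp => hUK p hp.1 hp.2.1 hp.2.2).trans
        (lintegral_mono fun x => ?_)
      rw [← ENNReal.ofReal_add (abs_nonneg _) (abs_nonneg _)]
      refine ENNReal.ofReal_le_ofReal ?_
      rw [abs_sub_comm (g n x)]
      exact abs_sub_le _ _ _
  have hlim' := (tendsto_const_nhds (x := Per m E V + Per m E W + ε)).add hlim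
  rw [add_zero] at hlim'
  exact (per_le_liminf hU (fun n => locLipOn_interp_cutoff hab hV hW hUV hUW (hf n) (hg n))
    hconv).trans ((liminf_le_liminf (Eventually.of_forall hbound)).trans hlim'.liminf_eq.le)

end Gluing

/-! ### Compact sets and good radii -/

section Radii

lemma exists_closedBall_subset [MetricSpace X] [ProperSpace X] {x : X} {ρ : ℝ} {U : Set X}
    (hU : IsOpen U) (h : closedBall x ρ ⊆ U) : ∃ ρ' > ρ, closedBall x ρ' ⊆ U := by
  rcases (closedBall x (ρ + 1) \ U).eq_empty_or_nonempty with h0 | h0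
  · exact ⟨ρ + 1, by linarith, sdiff_eq_empty.1 h0⟩
  · obtain ⟨p, hp, hmin⟩ := ((isCompact_closedBall x (ρ + 1)).diff hU).exists_isMinOn h0
      (f := fun q => dist q x) (by fun_prop)
    have hpρ : ρ < dist p x := by
      by_contra! hcon
      exact hp.2 (h hcon)
    refine ⟨(ρ + dist p x) / 2, by linarith, fun q hq => ?_⟩
    by_contra hqU
    have hp1 := mem_closedBall.1 hp.1
    have hq' := mem_closedBall.1 hq
    have : dist p x ≤ dist q x := hmin ⟨mem_closedBall.2 (by linarith), hqU⟩
    linarith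

variable [MetricSpace X] [MeasurableSpace X] {m : Measure X} {E F : Set X} {x : X} {ρ : ℝ}

lemma per_empty : Per m E ∅ = 0 := by
  have := per_le_liminf (m := m) (E := E) isOpen_empty (f := fun _ _ => 0)
    (fun _ => locLipOn_const _ _) (fun K hK _ => by simp [subset_empty_iff.1 hK])
  simpa using this

/-- The perimeter of `E` does not charge the sphere of radius `ρ` around `x`. -/
def GoodRadius (m : Measure X) (E : Set X) (x : X) (ρ : ℝ) : Prop :=
  ∀ ε : ℝ≥0∞, ε ≠ 0 → ∃ η > 0, Per m E (ball x (ρ + η) \ closedBall x (ρ - η)) ≤ ε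

lemma GoodRadius.exists_lt (h : GoodRadius m E x ρ) {ε : ℝ≥0∞} (hε : ε ≠ 0) {δ : ℝ}
    (hδ : 0 < δ) :
    ∃ η, 0 < η ∧ η < δ ∧ Per m E (ball x (ρ + η) \ closedBall x (ρ - η)) ≤ ε := by
  obtain ⟨η, hη, h⟩ := h ε hε
  refine ⟨min η (δ / 2), lt_min hη (by linarith), (min_le_right _ _).trans_lt (by linarith),
    (per_mono ?_).trans h⟩
  have := min_le_left η (δ / 2)
  exact sdiff_subset_sdiff (ball_subset_ball (by linarith))
    (closedBall_subset_closedBall (by linarith))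

lemma GoodRadius.congr [OpensMeasurableSpace X] (h : GoodRadius m E x ρ) {σ σ' : ℝ}
    (hσ : σ < ρ) (hσ' : ρ < σ') (hEF : m ((E ∆ F) ∩ (ball x σ' \ closedBall x σ)) = 0) :
    GoodRadius m F x ρ := by
  intro ε hε
  obtain ⟨η, hη, hη', h⟩ := h.exists_lt hε (lt_min (sub_pos.2 hσ) (sub_pos.2 hσ'))
  rw [lt_min_iff] at hη'
  refine ⟨η, hη, ?_⟩
  rwa [← per_congr (isOpen_ball.sdiff isClosed_closedBall)
    (measure_mono_null (inter_subset_inter_right _ ?_) hEF)]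
  exact sdiff_subset_sdiff (ball_subset_ball (by linarith))
    (closedBall_subset_closedBall (by linarith))

end Radii

section Splitting

variable [MetricSpace X] [MeasurableSpace X] [BorelSpace X] {m : Measure X} {E F : Set X}
  {x : X} {ρ : ℝ}

lemma exists_goodRadius {a b : ℝ} (hab : a < b) (hfin : Per m E (ball x b) < ∞) :
    ∃ ρ, a < ρ ∧ ρ < b ∧ GoodRadius m E x ρ := by
  set v : ℝ → ℝ≥0∞ := fun t => Per m E (ball x t)
  have hv : Monotone v := fun s t hst => per_mono (ball_subset_ball hst)
  obtain ⟨ρ, hρ, hρc⟩ : ∃ ρ ∈ Ioo a b, ContinuousAt v ρ := by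
    by_contra! hcon
    have : (Ioo a b).Countable := hv.countable_not_continuousAt.mono hcon
    exact absurd (Cardinal.Real.Ioo_countable_iff.1 this) (not_le.2 hab)
  have hvf : v ρ ≠ ∞ := ((hv hρ.2.le).trans_lt hfin).ne
  refine ⟨ρ, hρ.1, hρ.2, fun ε hε => ?_⟩
  have hε' : ε / 2 ≠ 0 := by simpa using hε
  have h1 : ∀ᶠ t in 𝓝 ρ, v t ≤ v ρ + ε / 2 ∧ v ρ ≤ v t + ε / 2 := by
    rcases eq_or_ne ε ∞ with rfl | hεi
    · simp [ENNReal.top_div]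
    have := (ENNReal.tendsto_nhds hvf).1 hρc (ε / 2) (pos_iff_ne_zero.2 hε')
    filter_upwards [this] with t ht
    exact ⟨ht.2, tsub_le_iff_right.1 ht.1⟩
  obtain ⟨η, hη, hηs⟩ := Metric.eventually_nhds_iff.1 h1
  have hm : η / 2 < η := by linarith
  have hle := (hηs (y := ρ + η / 2) (by simpa [abs_of_pos hη] using hη)).1
  have hge := (hηs (y := ρ - η / 2) (by simpa [abs_of_pos hη] using hη)).2
  refine ⟨η / 2, by linarith, ?_⟩
  have hadd := per_add_le (m := m) (E := E) (U₁ := ball x (ρ - η / 2))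
    (U₂ := ball x (ρ + η / 2) \ closedBall x (ρ - η / 2)) (V := ball x (ρ + η / 2))
    isOpen_ball (isOpen_ball.sdiff isClosed_closedBall) isOpen_ball
    (disjoint_left.2 fun p hp hp' => hp'.2 (ball_subset_closedBall hp))
    (ball_subset_ball (by linarith)) sdiff_subset
  have hfin' : Per m E (ball x (ρ - η / 2)) ≠ ∞ :=
    ((per_mono (ball_subset_ball (by linarith [hρ.2]))).trans_lt hfin).ne
  rw [← ENNReal.add_le_add_iff_left hfin']
  calc _ ≤ _ := hadd
    _ ≤ v ρ + ε / 2 := hle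
    _ ≤ v (ρ - η / 2) + ε / 2 + ε / 2 := by gcongr
    _ = v (ρ - η / 2) + ε := by rw [add_assoc, ENNReal.add_halves]

variable [ProperSpace X]

lemma per_glue_ball {U V W : Set X} {a b : ℝ} (hE : MeasurableSet E) (hab : a < b)
    (hU : IsOpen U) (hV : IsOpen V) (hW : IsOpen W)
    (hUV : ∀ p ∈ U, dist p x ≤ b → p ∈ V) (hUW : ∀ p ∈ U, a ≤ dist p x → p ∈ W)
    (hb : closedBall x b ⊆ U) :
    Per m E U ≤ Per m E V + Per m E W := by
  have hK : IsCompact (closedBall x b ∩ {p | a ≤ dist p x}) :=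
    (isCompact_closedBall x b).inter_right
      (isClosed_le continuous_const (continuous_id.dist continuous_const))
  refine per_glue (A := {x}) hE hab hU hV hW (by simpa only [infDist_singleton] using hUV)
    (by simpa only [infDist_singleton] using hUW) hK (fun p hp => hUV p (hb hp.1) hp.1)
    (fun p hp => hUW p (hb hp.1) hp.2) fun p _ h1 h2 => ?_
  rw [infDist_singleton] at h1 h2
  exact ⟨h2, h1⟩

/-- The perimeter is additive across a good sphere. -/
lemma GoodRadius.per_eq_add {U : Set X} (h : GoodRadius m E x ρ) (hE : MeasurableSet E)
    (hU : IsOpen U) (hρU : closedBall x ρ ⊆ U) :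
    Per m E U = Per m E (ball x ρ) + Per m E (U \ closedBall x ρ) := by
  refine le_antisymm ?_ (per_add_le isOpen_ball (hU.sdiff isClosed_closedBall) hU
    (disjoint_left.2 fun p hp hp' => hp'.2 (ball_subset_closedBall hp))
    (ball_subset_closedBall.trans hρU) sdiff_subset)
  refine ENNReal.le_of_forall_pos_le_add fun ε hε _ => ?_
  obtain ⟨ρ', hρ', hρ'U⟩ := exists_closedBall_subset hU hρU
  obtain ⟨η, hη, hη', hηε⟩ := h.exists_lt (ε := ε) (by simpa using hε.ne') (sub_pos.2 hρ')
  have hηU : closedBall x (ρ + η) ⊆ U :=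
    (closedBall_subset_closedBall (by linarith)).trans hρ'U
  have g1 : Per m E U ≤ Per m E (ball x (ρ + η)) + Per m E (U \ closedBall x ρ) := by
    refine per_glue_ball (x := x) (a := ρ + η / 3) (b := ρ + 2 * η / 3) hE (by linarith) hU
      isOpen_ball (hU.sdiff isClosed_closedBall) (fun p _ hp => mem_ball.2 (by linarith))
      (fun p hp hp' => ⟨hp, fun hp'' => ?_⟩)
      ((closedBall_subset_closedBall (by linarith)).trans hηU)
    have := mem_closedBall.1 hp''
    linarith
  have g2 : Per m E (ball x (ρ + η)) ≤
      Per m E (ball x ρ) + Per m E (ball x (ρ + η) \ closedBall x (ρ - η)) := by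
    refine per_glue_ball (x := x) (a := ρ - 2 * η / 3) (b := ρ - η / 3) hE (by linarith)
      isOpen_ball isOpen_ball (isOpen_ball.sdiff isClosed_closedBall)
      (fun p _ hp => mem_ball.2 (by linarith))
      (fun p hp hp' => ⟨hp, fun hp'' => ?_⟩) (closedBall_subset_ball (by linarith))
    have := mem_closedBall.1 hp''
    linarith
  calc Per m E U ≤ _ := g1
    _ ≤ Per m E (ball x ρ) + ε + Per m E (U \ closedBall x ρ) := by
      gcongr
      exact g2.trans (by gcongr)
    _ = _ := by ring

lemma HasLocFinPer.exists_isOpen (h : HasLocFinPer m E) (hE : MeasurableSet E) {K : Set X}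
    (hK : IsCompact K) : ∃ U, IsOpen U ∧ K ⊆ U ∧ Per m E U < ∞ := by
  suffices ∃ L, K ⊆ L ∧ IsCompact L ∧ ∃ U, IsOpen U ∧ L ⊆ U ∧ Per m E U < ∞ by
    obtain ⟨L, hKL, -, U, hU, hLU, hf⟩ := this
    exact ⟨U, hU, hKL.trans hLU, hf⟩
  refine hK.induction_on (p := fun s => ∃ L, s ⊆ L ∧ IsCompact L ∧
    ∃ U, IsOpen U ∧ L ⊆ U ∧ Per m E U < ∞) ?_ ?_ ?_ ?_
  · exact ⟨∅, Subset.rfl, isCompact_empty, ∅, isOpen_empty, Subset.rfl, by simp [per_empty]⟩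
  · rintro s t hst ⟨L, hL, h⟩
    exact ⟨L, hst.trans hL, h⟩
  · rintro s t ⟨L₁, hs, hL₁, U₁, hU₁, hLU₁, hf₁⟩ ⟨L₂, ht, hL₂, U₂, hU₂, hLU₂, hf₂⟩
    refine ⟨L₁ ∪ L₂, union_subset_union hs ht, hL₁.union hL₂, ?_⟩
    rcases L₁.eq_empty_or_nonempty with rfl | hne
    · exact ⟨U₂, hU₂, by simpa using hLU₂, hf₂⟩
    obtain ⟨δ₁, hδ₁, h₁⟩ := hL₁.exists_cthickening_subset_open hU₁ hLU₁
    obtain ⟨δ₂, hδ₂, h₂⟩ := hL₂.exists_cthickening_subset_open hU₂ hLU₂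
    set δ := min δ₁ δ₂
    have hδ : 0 < δ := lt_min hδ₁ hδ₂
    have h₁' : cthickening δ L₁ ⊆ U₁ := (cthickening_mono (min_le_left _ _) _).trans h₁
    have h₂' : cthickening δ L₂ ⊆ U₂ := (cthickening_mono (min_le_right _ _) _).trans h₂
    have hin : ∀ p, infDist p L₁ ≤ δ → p ∈ cthickening δ L₁ := fun p hp =>
      by
        rw [mem_cthickening_iff, ← ENNReal.ofReal_toReal (infEDist_ne_top hne)]
        exact ENNReal.ofReal_le_ofReal hp
    have hin₂ : ∀ p ∈ thickening (δ / 2) L₁ ∪ thickening (δ / 2) L₂, δ / 2 ≤ infDist p L₁ →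
        p ∈ cthickening δ L₂ := by
      rintro p (hp | hp) hp'
      · exact absurd ((mem_thickening_iff_infDist_lt hne).1 hp) (not_lt.2 hp')
      · exact thickening_subset_cthickening_of_le (by linarith) _ hp
    refine ⟨thickening (δ / 2) L₁ ∪ thickening (δ / 2) L₂,
      isOpen_thickening.union isOpen_thickening,
      union_subset_union (self_subset_thickening (by linarith) _)
        (self_subset_thickening (by linarith) _),
      lt_of_le_of_lt ?_ (ENNReal.add_lt_top.2 ⟨hf₁, hf₂⟩)⟩
    exact per_glue (A := L₁) (a := δ / 2) (b := δ) (K := cthickening δ L₁ ∩ cthickening δ L₂)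
      hE (by linarith) (isOpen_thickening.union isOpen_thickening) hU₁ hU₂
      (fun p _ hp => h₁' (hin p hp)) (fun p hp hp' => h₂' (hin₂ p hp hp'))
      ((hL₁.cthickening).inter_right isClosed_cthickening)
      (inter_subset_left.trans h₁') (inter_subset_right.trans h₂')
      fun p hp h1 h2 => ⟨hin p h2, hin₂ p hp h1⟩
  · intro y _
    obtain ⟨r, hr, hf⟩ := h y
    exact ⟨closedBall y (r / 2), mem_nhdsWithin_of_mem_nhds (closedBall_mem_nhds y (by linarith)),
      closedBall y (r / 2), Subset.rfl, isCompact_closedBall _ _, ball y r, isOpen_ball,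
      closedBall_subset_ball (by linarith), hf⟩

end Splitting

/-! ### Cutting off a ball -/

lemma exists_liminf_annulus_le [MeasurableSpace X] {ν : Measure X} [IsFiniteMeasure ν]
    {d : X → ℝ} (hd : Measurable d) {a b : ℝ} (hab : a < b) {h : ℕ → ℝ} (hh : ∀ n, 0 < h n) :
    ∃ t ∈ Ioo a b, liminf (fun n => ENNReal.ofReal (1 / h n) *
      ν {p | t ≤ d p ∧ d p ≤ t + h n}) atTop ≤ ENNReal.ofReal (1 / (b - a)) * ν univ := by
  let S : ℕ → Set (X × ℝ) := fun n => {q | q.2 ≤ d q.1 ∧ d q.1 ≤ q.2 + h n}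
  have hS : ∀ n, MeasurableSet (S n) := fun n =>
    (measurableSet_le measurable_snd (hd.comp measurable_fst)).inter
      (measurableSet_le (hd.comp measurable_fst) (measurable_snd.add_const _))
  have hG : ∀ n, Measurable fun t : ℝ => ENNReal.ofReal (1 / h n) *
      ν {p | t ≤ d p ∧ d p ≤ t + h n} := fun n =>
    (measurable_measure_prodMk_right (hS n)).const_mul _
  have hvol : volume (Ioo a b) = ENNReal.ofReal (b - a) := Real.volume_Ioo
  obtain ⟨t, ht, hle⟩ := exists_le_setLAverage (μ := volume) (s := Ioo a b)
    (f := fun t => liminf (fun n => ENNReal.ofReal (1 / h n) *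
      ν {p | t ≤ d p ∧ d p ≤ t + h n}) atTop) (by simp [hvol, hab]) (by simp [hvol])
      (Measurable.liminf hG).aemeasurable
  refine ⟨t, ht, hle.trans ?_⟩
  have hint : ∀ n, ∫⁻ t in Ioo a b, ENNReal.ofReal (1 / h n) *
      ν {p | t ≤ d p ∧ d p ≤ t + h n} ≤ ν univ := by
    intro n
    rw [lintegral_const_mul (f := fun t => ν {p | t ≤ d p ∧ d p ≤ t + h n}) _
      (measurable_measure_prodMk_right (hS n))]
    have h1 := Measure.prod_apply_symm (μ := ν) (ν := volume.restrict (Ioo a b)) (hS n)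
    have h2 := Measure.prod_apply (μ := ν) (ν := volume.restrict (Ioo a b)) (hS n)
    have h3 : ∫⁻ p, (volume.restrict (Ioo a b)) (Prod.mk p ⁻¹' S n) ∂ν ≤
        ∫⁻ _, ENNReal.ofReal (h n) ∂ν := by
      refine lintegral_mono fun p => (Measure.restrict_apply_le _ _).trans ?_
      calc volume (Prod.mk p ⁻¹' S n) ≤ volume (Icc (d p - h n) (d p)) :=
            measure_mono fun t ht => ⟨by have := ht.2; simp at this; linarith, ht.1⟩
        _ = ENNReal.ofReal (h n) := by rw [Real.volume_Icc]; congr 1; ring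
    have h4 : ∫⁻ t in Ioo a b, ν {p | t ≤ d p ∧ d p ≤ t + h n} ≤
        ENNReal.ofReal (h n) * ν univ := by
      refine (h1.symm.trans h2).le.trans (h3.trans ?_)
      simp
    calc _ ≤ ENNReal.ofReal (1 / h n) * (ENNReal.ofReal (h n) * ν univ) := by gcongr
      _ = ν univ := by
        rw [← mul_assoc, ← ENNReal.ofReal_mul (by have := hh n; positivity),
          one_div_mul_cancel (hh n).ne', ENNReal.ofReal_one, one_mul]
  rw [setLAverage_eq, hvol, ENNReal.div_eq_inv_mul, one_div,
    ENNReal.ofReal_inv_of_pos (sub_pos.2 hab)]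
  gcongr
  refine (lintegral_liminf_le hG).trans ?_
  exact liminf_le_of_frequently_le' (Frequently.of_forall hint)

lemma abs_interp_cutoff_zero_sub_le [MetricSpace X] {E : Set X} {x p : X} {t h : ℝ}
    (hh : 0 < h) (f : X → ℝ) :
    ENNReal.ofReal |interp (cutoff {x} t (t + h)) (fun _ => 0) f p -
      charFn (E \ closedBall x t) p| ≤ ENNReal.ofReal |f p - charFn E p| +
        (E ∩ {p | t ≤ dist p x ∧ dist p x ≤ t + h}).indicator (fun _ => 1) p := by
  have hab : t < t + h := by linarith
  rcases le_or_gt (dist p x) t with h1 | h1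
  · have e1 : cutoff {x} t (t + h) p = 1 := cutoff_eq_one hab (by rwa [infDist_singleton])
    have e2 : p ∉ E \ closedBall x t := fun hp => hp.2 (mem_closedBall.2 h1)
    simp [interp, e1, charFn, indicator_of_notMem e2]
  have e2 : charFn (E \ closedBall x t) p = charFn E p := by
    by_cases hp : p ∈ E <;> simp [charFn, hp, h1]
  rw [e2]
  rcases le_or_gt (t + h) (dist p x) with h2 | h2
  · have e1 : cutoff {x} t (t + h) p = 0 := cutoff_eq_zero hab (by rwa [infDist_singleton])
    simp [interp, e1]
  have e3 : (E ∩ {p | t ≤ dist p x ∧ dist p x ≤ t + h}).indicator (fun _ => (1 : ℝ≥0∞)) p =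
      ENNReal.ofReal (charFn E p) := by
    by_cases hp : p ∈ E <;> simp [charFn, hp, h1.le, h2.le]
  have hχ : 0 ≤ charFn E p := indicator_nonneg (fun _ _ => zero_le_one) p
  rw [e3, ← ENNReal.ofReal_add (abs_nonneg _) hχ]
  refine ENNReal.ofReal_le_ofReal ?_
  have h0 := cutoff_nonneg (A := {x}) (a := t) (b := t + h) p
  have h1 := cutoff_le_one (A := {x}) (a := t) (b := t + h) p
  have e : interp (cutoff {x} t (t + h)) (fun _ => 0) f p - charFn E p =
      (1 - cutoff {x} t (t + h) p) * (f p - charFn E p) - cutoff {x} t (t + h) p * charFn E p := by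
    unfold interp; ring
  rw [e]
  refine (abs_sub _ _).trans ?_
  rw [abs_mul, abs_mul, abs_of_nonneg h0, abs_of_nonneg (sub_nonneg.2 h1), abs_of_nonneg hχ]
  gcongr
  · exact mul_le_of_le_one_left (abs_nonneg _) (by linarith)
  · exact mul_le_of_le_one_left hχ h1

section Cut

variable [MetricSpace X] [MeasurableSpace X] [BorelSpace X] {m : Measure X} {E : Set X}

lemma exists_cut [ProperSpace X] {U : Set X} {x : X} {ρ ρ' : ℝ} (hU : IsOpen U)
    (hE : MeasurableSet E) (hρ : ρ' < ρ) (hρU : closedBall x ρ ⊆ U) (hfin : Per m E U < ∞)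
    (hpos : m (E ∩ ball x ρ) ≠ 0) (hm : m (ball x ρ) ≠ ∞) :
    ∃ t, ρ' < t ∧ t < ρ ∧ Per m (E \ closedBall x t) U + Per m E (ball x ρ') ≤
      Per m E U + ENNReal.ofReal (4 / (ρ - ρ')) * m (E ∩ ball x ρ) := by
  set D := ρ - ρ' with hD
  have hD0 : 0 < D := sub_pos.2 hρ
  set w := m (E ∩ ball x ρ) with hw
  have hwi : w ≠ ∞ := measure_ne_top_of_subset inter_subset_right hm
  set ε := ENNReal.ofReal (1 / D) * w with hε
  have hε0 : ε ≠ 0 := mul_ne_zero (by simpa using hD0) hpos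
  have hεi : ε ≠ ∞ := ENNReal.mul_ne_top ENNReal.ofReal_ne_top hwi
  obtain ⟨f₀, hf₀, hft₀, hfc₀⟩ := exists_seq_of_per_lt (ENNReal.lt_add_right hfin.ne hε0)
  set h : ℕ → ℝ := fun n => D / 4 * (1 / ((n : ℝ) + 1)) with hh
  have hhpos : ∀ n, 0 < h n := fun n => by positivity
  have hhle : ∀ n, h n ≤ D / 4 := fun n => by
    have : 1 / ((n : ℝ) + 1) ≤ 1 := by
      rw [div_le_one (by positivity)]; linarith [n.cast_nonneg (α := ℝ)]
    exact mul_le_of_le_one_right (by positivity) this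
  have hhlim : Tendsto h atTop (𝓝 0) := by
    simpa [hh] using (tendsto_one_div_add_atTop_nhds_zero_nat (𝕜 := ℝ)).const_mul (D / 4)
  obtain ⟨k, hk, hke⟩ := extraction_forall_of_eventually (P := fun n j =>
      ∫⁻ p in closedBall x ρ, ENNReal.ofReal |f₀ j p - charFn E p| ∂m <
        ENNReal.ofReal (h n * (1 / ((n : ℝ) + 1)))) fun n =>
    (hft₀ _ hρU (isCompact_closedBall x ρ)).eventually_lt_const (by
      rw [ENNReal.ofReal_pos]; exact mul_pos (hhpos n) (by positivity))
  have hν : IsFiniteMeasure (m.restrict (E ∩ ball x ρ)) := ⟨by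
    rw [Measure.restrict_apply_univ]; exact hwi.lt_top⟩
  have hdist : Measurable fun p => dist p x := (continuous_id.dist continuous_const).measurable
  obtain ⟨t, ht, hlim⟩ := exists_liminf_annulus_le (ν := m.restrict (E ∩ ball x ρ)) hdist
    (a := ρ') (b := ρ' + D / 2) (by linarith) hhpos
  have htρ : t + D / 4 < ρ := by have := ht.2; linarith
  refine ⟨t, ht.1, by linarith, ?_⟩
  let S : ℕ → Set X := fun n => {p | t ≤ dist p x ∧ dist p x ≤ t + h n}
  have hS : ∀ n, MeasurableSet (S n) := fun n =>
    (measurableSet_le measurable_const hdist).inter (measurableSet_le hdist measurable_const)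
  have hSρ : ∀ n, S n ⊆ ball x ρ := fun n p hp => by
    have := hp.2; have := hhle n; exact mem_ball.2 (by linarith)
  have hνS : ∀ n, m.restrict (E ∩ ball x ρ) (S n) = m (E ∩ S n) := fun n => by
    rw [Measure.restrict_apply (hS n)]
    congr 1
    ext p
    exact ⟨fun hp => ⟨hp.2.1, hp.1⟩, fun hp => ⟨hp.2, hp.1, hSρ n hp.2⟩⟩
  set c := ENNReal.ofReal (2 / D) * w + ε with hc
  have hci : c ≠ ∞ := ENNReal.add_ne_top.2 ⟨ENNReal.mul_ne_top ENNReal.ofReal_ne_top hwi, hεi⟩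
  have hlim' : liminf (fun n => ENNReal.ofReal (1 / h n) * m (E ∩ S n)) atTop < c := by
    simp only [← hνS]
    refine hlim.trans_lt ?_
    rw [Measure.restrict_apply_univ,
      show 1 / (ρ' + D / 2 - ρ') = 2 / D by rw [add_sub_cancel_left, one_div_div]]
    exact ENNReal.lt_add_right (ENNReal.mul_ne_top ENNReal.ofReal_ne_top hwi) hε0
  obtain ⟨j, hj, hjc⟩ := extraction_of_frequently_atTop
    (frequently_lt_of_liminf_lt (by isBoundedDefault) hlim')
  let f : ℕ → X → ℝ := fun n => f₀ (k (j n))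
  let e : ℕ → ℝ≥0∞ := fun n => ∫⁻ p in closedBall x ρ, ENNReal.ofReal |f n p - charFn E p| ∂m
  let F : ℕ → X → ℝ := fun n => interp (cutoff {x} t (t + h (j n))) (fun _ => 0) (f n)
  have hab : ∀ n, t < t + h n := fun n => by linarith [hhpos n]
  have hf : ∀ n, LocLipOn U (f n) := fun n => hf₀ _
  have hF : ∀ n, LocLipOn U (F n) := fun n =>
    locLipOn_interp_cutoff (hab _) hU hU (fun _ hp _ => hp) (fun _ hp _ => hp)
      (locLipOn_const U 0) (hf n)
  have hκe : ∀ n, ENNReal.ofReal (1 / h (j n)) * e n ≤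
      ENNReal.ofReal (1 / (((j n : ℕ) : ℝ) + 1)) := fun n => by
    have hp := hhpos (j n)
    calc _ ≤ ENNReal.ofReal (1 / h (j n)) *
          ENNReal.ofReal (h (j n) * (1 / (((j n : ℕ) : ℝ) + 1))) := by
            gcongr; exact (hke (j n)).le
      _ = _ := by
        rw [← ENNReal.ofReal_mul (by positivity), ← mul_assoc, one_div_mul_cancel hp.ne', one_mul]
  have hκlim : Tendsto (fun n => ENNReal.ofReal (1 / h (j n)) * e n) atTop (𝓝 0) := by
    have h1 : Tendsto (fun n => ENNReal.ofReal (1 / (((j n : ℕ) : ℝ) + 1))) atTop (𝓝 0) := by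
      have := (tendsto_one_div_add_atTop_nhds_zero_nat (𝕜 := ℝ)).comp hj.tendsto_atTop
      simpa using ENNReal.tendsto_ofReal this
    exact tendsto_of_tendsto_of_tendsto_of_le_of_le tendsto_const_nhds h1
      (fun _ => zero_le) hκe
  have hmS : ∀ n, m (E ∩ S (j n)) ≤ ENNReal.ofReal (h (j n)) * c := fun n => by
    have hp := hhpos (j n)
    calc m (E ∩ S (j n)) = ENNReal.ofReal (h (j n)) *
          (ENNReal.ofReal (1 / h (j n)) * m (E ∩ S (j n))) := by
            rw [← mul_assoc, ← ENNReal.ofReal_mul hp.le, mul_one_div_cancel hp.ne',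
              ENNReal.ofReal_one, one_mul]
      _ ≤ _ := by gcongr; exact (hjc n).le
  have hmSlim : Tendsto (fun n => ENNReal.ofReal (h (j n)) * c) atTop (𝓝 0) := by
    have := ENNReal.Tendsto.mul_const (ENNReal.tendsto_ofReal (hhlim.comp hj.tendsto_atTop))
      (b := c) (Or.inr hci)
    simpa using this
  have hFt : TendstoL1loc m U F (charFn (E \ closedBall x t)) := by
    intro K hK hKc
    have h1 := (((hft₀.comp hk.tendsto_atTop).comp hj.tendsto_atTop) K hK hKc).add hmSlim
    rw [add_zero] at h1
    refine tendsto_of_tendsto_of_tendsto_of_le_of_le tendsto_const_nhds h1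
      (fun _ => zero_le) fun n => ?_
    refine (lintegral_mono fun p => abs_interp_cutoff_zero_sub_le (hhpos (j n)) (f n)).trans ?_
    rw [lintegral_add_left' (aemeasurable_ofReal_abs_sub hKc.measurableSet
      ((hf n).continuousOn.mono hK) (measurable_charFn hE))]
    refine add_le_add le_rfl (le_trans ?_ (hmS n))
    refine (setLIntegral_le_lintegral _ _).trans ?_
    rw [lintegral_indicator (hE.inter (hS _)), setLIntegral_one]
  have hbound : ∀ n, ∫⁻ p in U, slopeOn U (F n) p ∂m +
      ∫⁻ p in ball x ρ', slopeOn (ball x ρ') (f n) p ∂m ≤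
      Per m E U + ε + c + ENNReal.ofReal (1 / h (j n)) * e n := by
    intro n
    have hp := hhpos (j n)
    have hC2 : MeasurableSet {p | t ≤ infDist p {x}} := by
      simpa only [infDist_singleton] using measurableSet_le measurable_const hdist
    have h1 := lintegral_slopeOn_interp_cutoff_le (m := m) (A := {x}) (hab (j n)) hU hU hU
      (fun _ hp _ => hp) (fun _ hp _ => hp) (f := fun _ => 0) continuousOn_const
      (hf n).continuousOn
    have h2 : ∫⁻ p in U, {p | infDist p {x} ≤ t + h (j n)}.indicator
        (slopeOn U fun _ => 0) p ∂m = 0 := by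
      have : ∀ p, {p | infDist p {x} ≤ t + h (j n)}.indicator (slopeOn U fun _ => 0) p = 0 :=
        fun p => indicator_apply_eq_zero.2 fun _ => slopeOn_const _ _ _
      rw [lintegral_congr this, lintegral_zero]
    rw [h2, zero_add] at h1
    have h3 : ∫⁻ p in U, {p | t ≤ infDist p {x}}.indicator (slopeOn U (f n)) p ∂m +
        ∫⁻ p in ball x ρ', slopeOn (ball x ρ') (f n) p ∂m ≤ Per m E U + ε := by
      refine le_trans ?_ (hfc₀ (k (j n))).le
      rw [lintegral_indicator hC2, Measure.restrict_restrict hC2]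
      have hsub : ball x ρ' ⊆ U :=
        (ball_subset_closedBall.trans (closedBall_subset_closedBall hρ.le)).trans hρU
      refine (add_le_add le_rfl (lintegral_mono fun p => slopeOn_mono hsub (f n) p)).trans ?_
      rw [← lintegral_union measurableSet_ball]
      · exact lintegral_mono_set (union_subset inter_subset_right hsub)
      · refine disjoint_left.2 fun p hp hp' => ?_
        have := hp.1
        simp only [mem_ofPred_eq, infDist_singleton] at this
        have := mem_ball.1 hp'
        linarith [ht.1]
    have h4 : ∫⁻ p in U ∩ {p | t ≤ infDist p {x} ∧ infDist p {x} ≤ t + h (j n)},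
        ENNReal.ofReal |0 - f n p| ∂m ≤ e n + m (E ∩ S (j n)) := by
      simp only [infDist_singleton]
      change ∫⁻ p in U ∩ S (j n), _ ∂m ≤ _
      calc ∫⁻ p in U ∩ S (j n), ENNReal.ofReal |0 - f n p| ∂m
          ≤ ∫⁻ p in S (j n), (ENNReal.ofReal |f n p - charFn E p| +
            E.indicator (fun _ => 1) p) ∂m := by
            refine (lintegral_mono_set inter_subset_right).trans (lintegral_mono fun p => ?_)
            have e3 : E.indicator (fun _ => (1 : ℝ≥0∞)) p = ENNReal.ofReal (charFn E p) := by
              by_cases hp : p ∈ E <;> simp [charFn, hp]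
            have hχ : 0 ≤ charFn E p := indicator_nonneg (fun _ _ => zero_le_one) p
            rw [e3, ← ENNReal.ofReal_add (abs_nonneg _) hχ]
            refine ENNReal.ofReal_le_ofReal ?_
            have := abs_add_le (f n p - charFn E p) (charFn E p)
            rw [zero_sub, abs_neg]
            rwa [sub_add_cancel, abs_of_nonneg hχ] at this
        _ = ∫⁻ p in S (j n), ENNReal.ofReal |f n p - charFn E p| ∂m + m (E ∩ S (j n)) := by
            rw [lintegral_add_right _ (measurable_const.indicator hE), lintegral_indicator hE,
              setLIntegral_one, Measure.restrict_apply hE]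
        _ ≤ e n + m (E ∩ S (j n)) := by
            exact add_le_add (lintegral_mono_set ((hSρ _).trans ball_subset_closedBall)) le_rfl
    calc _ ≤ (∫⁻ p in U, {p | t ≤ infDist p {x}}.indicator (slopeOn U (f n)) p ∂m +
          ENNReal.ofReal (1 / h (j n)) * (e n + m (E ∩ S (j n)))) +
          ∫⁻ p in ball x ρ', slopeOn (ball x ρ') (f n) p ∂m := by
            gcongr
            refine h1.trans ?_
            rw [add_sub_cancel_left]
            gcongr
            exact le_rfl
      _ = (∫⁻ p in U, {p | t ≤ infDist p {x}}.indicator (slopeOn U (f n)) p ∂m +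
          ∫⁻ p in ball x ρ', slopeOn (ball x ρ') (f n) p ∂m) +
          ENNReal.ofReal (1 / h (j n)) * m (E ∩ S (j n)) +
          ENNReal.ofReal (1 / h (j n)) * e n := by ring
      _ ≤ _ := by
            gcongr
            exact (hjc n).le
  have hsub : ball x ρ' ⊆ U :=
    (ball_subset_closedBall.trans (closedBall_subset_closedBall hρ.le)).trans hρU
  have hfin1 := per_le_liminf hU hF hFt
  have hfin2 := per_le_liminf (m := m) (E := E) isOpen_ball (fun n => (hf n).mono hsub)
    (((hft₀.comp hk.tendsto_atTop).comp hj.tendsto_atTop).mono hsub)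
  have hlast := (tendsto_const_nhds (x := Per m E U + ε + c)).add hκlim
  rw [add_zero] at hlast
  calc _ ≤ _ := add_le_add hfin1 hfin2
    _ ≤ _ := ENNReal.add_liminf_le _ _
    _ ≤ _ := liminf_le_liminf (Eventually.of_forall hbound)
    _ = Per m E U + ε + c := hlast.liminf_eq
    _ = Per m E U +
        (ENNReal.ofReal (1 / D) + ENNReal.ofReal (2 / D) + ENNReal.ofReal (1 / D)) * w := by
      rw [hc, hε]; ring
    _ = _ := by
      rw [← ENNReal.ofReal_add (by positivity) (by positivity),
        ← ENNReal.ofReal_add (by positivity) (by positivity)]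
      congr 3
      ring

end Cut

section Doubling

variable [MetricSpace X] [MeasurableSpace X] {m : Measure X}

lemma UnifLocDoublingWith.exists_ball_mul_le {C : ℝ → ℝ} (h : UnifLocDoublingWith C m)
    (Λ S : ℝ) :
    ∃ K : ℝ≥0∞, K ≠ ∞ ∧ ∀ x r, 0 < r → r ≤ S → m (ball x (Λ * r)) ≤ K * m (ball x r) := by
  suffices ∀ n : ℕ, ∃ K : ℝ≥0∞, K ≠ ∞ ∧
      ∀ x r, 0 < r → r ≤ S → m (ball x (2 ^ n * r)) ≤ K * m (ball x r) by
    obtain ⟨n, hn⟩ := pow_unbounded_of_one_lt Λ one_lt_two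
    obtain ⟨K, hK, h1⟩ := this n
    exact ⟨K, hK, fun x r h0 hS =>
      (measure_mono (ball_subset_ball (by gcongr))).trans (h1 x r h0 hS)⟩
  intro n
  induction n with
  | zero => exact ⟨1, one_ne_top, fun x r _ _ => by simp⟩
  | succ n ih =>
    obtain ⟨K, hK, h1⟩ := ih
    refine ⟨ENNReal.ofReal (C (2 ^ n * S + 1)) * K, mul_ne_top ofReal_ne_top hK,
      fun x r h0 hS => ?_⟩
    have h2 : 2 ^ n * r ≤ 2 ^ n * S := by gcongr
    have h3 : 0 < 2 ^ n * r := by positivity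
    have := h (2 ^ n * S + 1) (by linarith) x _ h3 (by linarith)
    rw [pow_succ', mul_assoc, mul_assoc]
    exact this.trans (by gcongr; exact h1 x r h0 hS)

lemma UnifLocDoublingWith.exists_ball_le {C : ℝ → ℝ} (h : UnifLocDoublingWith C m)
    {r : ℝ} (hr : 0 < r) (R : ℝ) :
    ∃ K : ℝ≥0∞, K ≠ ∞ ∧ ∀ x, m (ball x R) ≤ K * m (ball x r) := by
  obtain ⟨K, hK, h1⟩ := h.exists_ball_mul_le (R / r) r
  refine ⟨K, hK, fun x => ?_⟩
  simpa [div_mul_cancel₀ R hr.ne'] using h1 x r hr le_rfl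

lemma UnifLocDoublingWith.measure_ball_ne_zero {C : ℝ → ℝ} (h : UnifLocDoublingWith C m)
    (hm : m ≠ 0) (x : X) {r : ℝ} (hr : 0 < r) : m (ball x r) ≠ 0 := by
  intro h0
  refine hm (Measure.measure_univ_eq_zero.1 ?_)
  rw [← iUnion_ball_nat x, measure_iUnion_null_iff]
  intro n
  obtain ⟨K, -, hK⟩ := h.exists_ball_le hr n
  simpa [h0] using hK x

lemma BoundedlyFinite.measure_ball_ne_top (h : BoundedlyFinite m) (x : X) (r : ℝ) :
    m (ball x r) ≠ ∞ := (h _ isBounded_ball).ne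

/-- The number of `δ`-separated points in a ball is controlled by the measures of balls. -/
lemma card_le_of_separated [OpensMeasurableSpace X] {p : X} {R δ : ℝ} {C : ℝ≥0∞} {T : Finset X}
    (hT : ∀ s ∈ T, ∀ t ∈ T, s ≠ t → δ ≤ dist s t) (hδ : 0 < δ) (hTp : ∀ t ∈ T, dist t p < R)
    (hC : ∀ t ∈ T, m (ball p (R + δ)) ≤ C * m (ball t (δ / 2)))
    (h0 : m (ball p (R + δ)) ≠ 0) (hi : m (ball p (R + δ)) ≠ ∞) : (T.card : ℝ≥0∞) ≤ C := by
  have h1 : ∑ t ∈ T, m (ball t (δ / 2)) ≤ m (ball p (R + δ)) := by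
    rw [← measure_biUnion_finset _ fun _ _ => measurableSet_ball]
    · refine measure_mono (iUnion₂_subset fun t ht => ball_subset_ball' ?_)
      linarith [hTp t ht]
    · intro s hs t ht hst
      exact ball_disjoint_ball (by linarith [hT s hs t ht hst])
  have h2 : T.card * m (ball p (R + δ)) ≤ C * m (ball p (R + δ)) := by
    calc T.card * m (ball p (R + δ)) = ∑ t ∈ T, m (ball p (R + δ)) := by simp
      _ ≤ ∑ t ∈ T, C * m (ball t (δ / 2)) := Finset.sum_le_sum hC
      _ = C * ∑ t ∈ T, m (ball t (δ / 2)) := by rw [Finset.mul_sum]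
      _ ≤ C * m (ball p (R + δ)) := by gcongr
  exact (ENNReal.mul_le_mul_iff_left h0 hi).1 h2

/-- Balls have finite separated nets. -/
lemma exists_finset_net [OpensMeasurableSpace X] {p : X} {R δ : ℝ} {C : ℝ≥0∞} (hCi : C ≠ ∞)
    (hδ : 0 < δ) (hC : ∀ z ∈ ball p R, m (ball p (R + δ)) ≤ C * m (ball z (δ / 2)))
    (h0 : m (ball p (R + δ)) ≠ 0) (hi : m (ball p (R + δ)) ≠ ∞) :
    ∃ T : Finset X, (∀ t ∈ T, t ∈ ball p R) ∧ (∀ s ∈ T, ∀ t ∈ T, s ≠ t → δ ≤ dist s t) ∧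
      ∀ z ∈ ball p R, ∃ t ∈ T, dist z t ≤ δ := by
  obtain ⟨ε, rfl⟩ : ∃ ε : NNReal, δ = ε := ⟨⟨δ, hδ.le⟩, rfl⟩
  have hsep : ∀ S : Set X, IsSeparated ε S → ∀ s ∈ S, ∀ t ∈ S, s ≠ t → (ε : ℝ) ≤ dist s t := by
    intro S hS s hs t ht hst
    have := (hS hs ht hst).le
    rwa [edist_nndist, ENNReal.coe_le_coe] at this
  obtain ⟨N, hN⟩ := ENNReal.exists_nat_gt hCi
  have hcard : ∀ T : Finset X, ↑T ⊆ ball p R → IsSeparated (ε : ℝ≥0∞) (T : Set X) → T.card ≤ N := by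
    intro T hT hs
    have := card_le_of_separated (T := T) (hsep _ hs) hδ hT (fun t ht => hC t (hT ht)) h0 hi
    exact_mod_cast (this.trans_lt hN).le
  have hfin : packingNumber ε (ball p R) ≠ ⊤ := by
    refine ne_top_of_le_ne_top (ENat.natCast_ne_top N) (iSup_le fun S => iSup₂_le fun hS hs => ?_)
    by_contra! hcon
    obtain ⟨T, hTS, hT⟩ := exists_subset_encard_eq (Order.add_one_le_of_lt hcon)
    have hTf : T.Finite := finite_of_encard_eq_coe (k := N + 1) (by simpa using hT)
    have h1 := hcard hTf.toFinset (by simpa using hTS.trans hS) (by simpa using hs.subset hTS)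
    rw [hTf.encard_eq_coe_toFinset_card] at hT
    have : hTf.toFinset.card = N + 1 := by exact_mod_cast hT
    omega
  have hTf : (maximalSeparatedSet ε (ball p R)).Finite := by
    rw [← encard_ne_top_iff, encard_maximalSeparatedSet hfin]
    exact hfin
  refine ⟨hTf.toFinset, fun t ht => maximalSeparatedSet_subset (by simpa using ht), fun s hs t ht =>
    hsep _ isSeparated_maximalSeparatedSet s (by simpa using hs) t (by simpa using ht),
    fun z hz => ?_⟩
  obtain ⟨t, ht, hzt⟩ := isCover_maximalSeparatedSet hfin hz
  have : edist z t ≤ ε := hzt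
  rw [edist_nndist, ENNReal.coe_le_coe] at this
  exact ⟨t, by simpa using ht, this⟩

lemma UnifLocDoublingWith.properSpace [OpensMeasurableSpace X] [CompleteSpace X] {C : ℝ → ℝ}
    (h : UnifLocDoublingWith C m) (hm : m ≠ 0) (hb : BoundedlyFinite m) : ProperSpace X := by
  refine ⟨fun x R => ?_⟩
  refine (TotallyBounded.subset (closedBall_subset_ball (lt_add_one R)) ?_).isCompact_of_isClosed
    isClosed_closedBall
  rw [Metric.totallyBounded_iff]
  intro ε hε
  rcases (ball x (R + 1)).eq_empty_or_nonempty with h0 | h0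
  · exact ⟨∅, finite_empty, by simp [h0]⟩
  have hR := pos_of_mem_ball h0.some_mem
  obtain ⟨K, hK, hKx⟩ := h.exists_ball_le (r := ε / 2 / 2) (by positivity)
    (2 * (R + 1) + ε / 2)
  have hsub : ∀ z ∈ ball x (R + 1), ball x (R + 1 + ε / 2) ⊆ ball z (2 * (R + 1) + ε / 2) := by
    intro z hz
    refine ball_subset_ball' ?_
    rw [dist_comm]
    linarith [mem_ball.1 hz]
  obtain ⟨T, -, -, hT⟩ := exists_finset_net (m := m) (p := x) (R := R + 1) (δ := ε / 2) hK
    (by positivity) (fun z hz => le_trans (measure_mono (hsub z hz)) (hKx z))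
    (h.measure_ball_ne_zero hm x (by positivity)) (hb.measure_ball_ne_top x _)
  refine ⟨T, T.finite_toSet, fun z hz => ?_⟩
  obtain ⟨t, ht, hzt⟩ := hT z hz
  exact mem_biUnion ht (mem_ball.2 (by linarith))

end Doubling

section Density

variable [MetricSpace X] [MeasurableSpace X] {m : Measure X} {E : Set X} {x : X}

lemma UnifLocDoublingWith.isUnifLocDoublingMeasure {C : ℝ → ℝ} (h : UnifLocDoublingWith C m) :
    IsUnifLocDoublingMeasure m := by
  obtain ⟨K, hKx⟩ : ∃ K : NNReal, ∀ x r, 0 < r → r < 2 →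
      m (ball x (2 * r)) ≤ K * m (ball x r) :=
    ⟨(C 2).toNNReal, fun x r h0 h1 => h 2 two_pos x r h0 h1⟩
  refine ⟨K ^ 2, ?_⟩
  filter_upwards [Ioo_mem_nhdsGT (zero_lt_one' ℝ)] with r hr x
  have h1 := hKx x r hr.1 (by linarith [hr.2])
  have h2 := hKx x (2 * r) (by linarith [hr.1]) (by linarith [hr.2])
  calc m (closedBall x (2 * r)) ≤ m (ball x (2 * (2 * r))) :=
        measure_mono (closedBall_subset_ball (by linarith [hr.1]))
    _ ≤ K * (K * m (ball x r)) := h2.trans (by gcongr)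
    _ ≤ (K ^ 2 : NNReal) * m (closedBall x r) := by
      rw [← mul_assoc, sq, coe_mul]
      gcongr
      exact ball_subset_closedBall

lemma measure_inter_le_of_mem_essExt (hx : x ∈ essExt m E) {ε : ℝ≥0∞} (hε : ε ≠ 0)
    (h0 : ∀ r, 0 < r → m (ball x r) ≠ 0) (hi : ∀ r, m (ball x r) ≠ ∞) :
    ∃ r₀ > 0, ∀ r, 0 < r → r < r₀ → m (E ∩ ball x r) ≤ ε * m (ball x r) := by
  have h1 : ∀ᶠ r : ℝ in 𝓝[>] 0, m (E ∩ ball x r) / m (ball x r) < ε :=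
    (tendsto_order.1 hx).2 ε (pos_iff_ne_zero.2 hε)
  obtain ⟨r₀, hr₀, h2⟩ := mem_nhdsGT_iff_exists_Ioo_subset.1 h1
  refine ⟨r₀, hr₀, fun r hr hr' => ?_⟩
  exact (ENNReal.div_le_iff (h0 r hr) (hi r)).1 (le_of_lt (h2 ⟨hr, hr'⟩))

lemma essExt_compl (hE : MeasurableSet E) (h0 : ∀ r, 0 < r → m (ball x r) ≠ 0)
    (hi : ∀ r, m (ball x r) ≠ ∞) : x ∈ essExt m Eᶜ ↔ x ∈ essInt m E := by
  have key : ∀ F : Set X, MeasurableSet F → ∀ r > 0,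
      m (Fᶜ ∩ ball x r) / m (ball x r) = 1 - m (F ∩ ball x r) / m (ball x r) := by
    intro F hF r hr
    have h1 := measure_inter_add_sdiff (μ := m) (ball x r) hF
    have h2 : m (F ∩ ball x r) ≠ ∞ := measure_ne_top_of_subset inter_subset_right (hi r)
    rw [inter_comm] at h2
    rw [← ENNReal.div_self (h0 r hr) (hi r), ← ENNReal.sub_div fun _ _ => h0 r hr]
    congr 1
    rw [← h1, inter_comm F]
    rw [ENNReal.add_sub_cancel_left h2, sdiff_eq, inter_comm]
  constructor
  · intro h
    have h2 : Tendsto (fun r : ℝ => 1 - m (Eᶜ ∩ ball x r) / m (ball x r)) (𝓝[>] 0) (𝓝 (1 - 0)) :=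
      ENNReal.Tendsto.sub tendsto_const_nhds h (Or.inl one_ne_top)
    rw [tsub_zero] at h2
    refine h2.congr' ?_
    filter_upwards [self_mem_nhdsWithin] with r hr
    rw [← key _ hE.compl r hr, compl_compl]
  · intro h
    have h2 : Tendsto (fun r : ℝ => 1 - m (E ∩ ball x r) / m (ball x r)) (𝓝[>] 0) (𝓝 (1 - 1)) :=
      ENNReal.Tendsto.sub tendsto_const_nhds h (Or.inl one_ne_top)
    rw [tsub_self] at h2
    refine h2.congr' ?_
    filter_upwards [self_mem_nhdsWithin] with r hr
    rw [← key _ hE r hr]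

lemma UnifLocDoublingWith.ae_mem_essExt [BorelSpace X] [SecondCountableTopology X] {C : ℝ → ℝ}
    (h : UnifLocDoublingWith C m) (hm : m ≠ 0) (hb : BoundedlyFinite m) (hE : MeasurableSet E) :
    ∀ᵐ x ∂m, x ∉ E → x ∈ essExt m E := by
  have := h.isUnifLocDoublingMeasure
  have : IsLocallyFiniteMeasure m :=
    ⟨fun x => ⟨ball x 1, ball_mem_nhds x one_pos, hb _ isBounded_ball⟩⟩
  filter_upwards
    [(IsUnifLocDoublingMeasure.vitaliFamily m 1).ae_tendsto_measure_inter_div_of_measurableSet hE]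
    with x hx hxE
  rw [indicator_of_notMem hxE] at hx
  have h1 : Tendsto (fun r : ℝ => m (E ∩ closedBall x r) / m (closedBall x r)) (𝓝[>] 0) (𝓝 0) :=
    hx.comp (IsUnifLocDoublingMeasure.tendsto_closedBall_filterAt m _ _ tendsto_id
      (by filter_upwards [self_mem_nhdsWithin] with r hr; simpa using (mem_Ioi.1 hr).le))
  obtain ⟨K, hKi, hKx⟩ : ∃ K : ℝ≥0∞, K ≠ ∞ ∧ ∀ x r, 0 < r → r < 1 →
      m (ball x (2 * r)) ≤ K * m (ball x r) :=
    ⟨_, ofReal_ne_top, fun x r h0 h1 => h 1 one_pos x r h0 h1⟩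
  have h2 : Tendsto (fun r : ℝ => K * (m (E ∩ closedBall x r) / m (closedBall x r))) (𝓝[>] 0)
      (𝓝 (K * 0)) := ENNReal.Tendsto.const_mul h1 (Or.inr hKi)
  rw [mul_zero] at h2
  refine tendsto_of_tendsto_of_tendsto_of_le_of_le' tendsto_const_nhds h2
    (Eventually.of_forall fun _ => zero_le) ?_
  filter_upwards [Ioo_mem_nhdsGT (zero_lt_one' ℝ)] with r hr
  have hc : m (closedBall x r) ≤ K * m (ball x r) :=
    (measure_mono (closedBall_subset_ball (by linarith [hr.1]))).trans (hKx x r hr.1 hr.2)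
  have hb0 := h.measure_ball_ne_zero hm x hr.1
  have hbi := hb.measure_ball_ne_top x r
  have hc0 : m (closedBall x r) ≠ 0 := fun hz => hb0 (measure_mono_null ball_subset_closedBall hz)
  have hci : m (closedBall x r) ≠ ∞ := (hb _ isBounded_closedBall).ne
  rw [ENNReal.div_le_iff hb0 hbi]
  calc m (E ∩ ball x r) ≤ m (E ∩ closedBall x r) :=
        measure_mono (inter_subset_inter_right _ ball_subset_closedBall)
    _ = m (E ∩ closedBall x r) / m (closedBall x r) * m (closedBall x r) :=
        (ENNReal.div_mul_cancel hc0 hci).symm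
    _ ≤ m (E ∩ closedBall x r) / m (closedBall x r) * (K * m (ball x r)) := by gcongr
    _ = _ := by ring

end Density

section Isoperimetric

lemma measure_inter_le_lintegral_abs_sub [MeasurableSpace X] {m : Measure X} {E B : Set X}
    (hE : MeasurableSet E) (hB : MeasurableSet B)
    (h : 2 * m (E ∩ B) ≤ m B) (hfin : m B ≠ ∞) (c : ℝ) :
    m (E ∩ B) ≤ ∫⁻ x in B, ENNReal.ofReal |charFn E x - c| ∂m := by
  have hfin' : m (E ∩ B) ≠ ∞ := measure_ne_top_of_subset inter_subset_right hfin
  have h1 : m (E ∩ B) ≤ m (B \ E) := by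
    rw [← measure_inter_add_sdiff B hE, inter_comm B, two_mul] at h
    exact (ENNReal.add_le_add_iff_left hfin').1 h
  have h2 : ∫⁻ x in E ∩ B, ENNReal.ofReal |charFn E x - c| ∂m =
      ENNReal.ofReal |1 - c| * m (E ∩ B) := by
    rw [← setLIntegral_const]
    exact setLIntegral_congr_fun (hE.inter hB) fun x hx => by simp [hx.1]
  have h3 : ∫⁻ x in B \ E, ENNReal.ofReal |charFn E x - c| ∂m = ENNReal.ofReal |c| * m (B \ E) := by
    rw [← setLIntegral_const]
    exact setLIntegral_congr_fun (hB.diff hE) fun x hx => by simp [hx.2]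
  have h4 : 1 ≤ ENNReal.ofReal |1 - c| + ENNReal.ofReal |c| := by
    rw [← ENNReal.ofReal_add (abs_nonneg _) (abs_nonneg _), ENNReal.one_le_ofReal]
    calc (1 : ℝ) = |(1 - c) + c| := by simp
      _ ≤ _ := abs_add_le _ _
  calc m (E ∩ B) = 1 * m (E ∩ B) := (one_mul _).symm
    _ ≤ (ENNReal.ofReal |1 - c| + ENNReal.ofReal |c|) * m (E ∩ B) := by gcongr
    _ ≤ ENNReal.ofReal |1 - c| * m (E ∩ B) + ENNReal.ofReal |c| * m (B \ E) := by
      rw [add_mul]; gcongr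
    _ = ∫⁻ x in B, ENNReal.ofReal |charFn E x - c| ∂m := by
      rw [← h2, ← h3, inter_comm, lintegral_inter_add_sdiff _ _ hE]

variable [MetricSpace X] [MeasurableSpace X] [BorelSpace X] {m : Measure X} {E : Set X}

/-- A relative isoperimetric inequality. -/
lemma WeakPoincareWith.measure_inter_le [ProperSpace X] {lam : ℝ} {C : ℝ → ℝ}
    (h : WeakPoincareWith lam C m) (hlam : 1 ≤ lam) (hC : 0 < C 1)
    (hb : BoundedlyFinite m) (h0 : ∀ x r, 0 < r → m (ball x r) ≠ 0) (hE : MeasurableSet E)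
    {z : X} {δ : ℝ} (hδ : 0 < δ) (hδ1 : δ < 1)
    (hm : 2 * m (E ∩ ball z δ) ≤ m (ball z δ)) :
    m (E ∩ ball z δ) ≤ ENNReal.ofReal (C 1 * δ) * Per m E (ball z (2 * lam * δ)) := by
  have hlδ : δ ≤ lam * δ := by nlinarith
  set q := ENNReal.ofReal (C 1 * δ) with hq
  set V := ball z (2 * lam * δ) with hV
  suffices ∀ c, Per m E V < c → m (E ∩ ball z δ) ≤ q * c by
    have hq0 : q ≠ 0 := by simpa [hq] using mul_pos hC hδ
    rw [mul_comm, ← ENNReal.div_le_iff hq0 ofReal_ne_top]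
    refine le_of_forall_gt_imp_ge_of_dense fun c hc => ?_
    rw [ENNReal.div_le_iff hq0 ofReal_ne_top, mul_comm]
    exact this c hc
  intro c hc
  obtain ⟨f, hf, hft, hfc⟩ := exists_seq_of_per_lt hc
  set g : ℕ → X → ℝ := fun n => interp (cutoff {z} (lam * δ) (3 / 2 * lam * δ)) (f n) fun _ => 0
  have hg : ∀ n, LocLipOn univ (g n) := fun n =>
    locLipOn_interp_cutoff (by nlinarith) isOpen_ball isOpen_univ
      (fun p _ hp => by
        rw [infDist_singleton] at hp
        exact mem_ball.2 (by nlinarith)) (fun _ _ _ => mem_univ _) (hf n) (locLipOn_const _ _)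
  have hgf : ∀ n, EqOn (g n) (f n) (ball z (lam * δ)) := fun n p hp => by
    have : infDist p {z} ≤ lam * δ := by
      rw [infDist_singleton]; exact (mem_ball.1 hp).le
    have hlt : lam * δ < 3 / 2 * lam * δ := by nlinarith
    simp [g, interp, cutoff_eq_one hlt this]
  have hlV : ball z (lam * δ) ⊆ V := ball_subset_ball (by nlinarith)
  have hslope : ∀ n, ∫⁻ y in ball z (lam * δ), mSlope (g n) y ∂m ≤ c := fun n => by
    calc ∫⁻ y in ball z (lam * δ), mSlope (g n) y ∂m
        = ∫⁻ y in ball z (lam * δ), slopeOn V (f n) y ∂m :=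
          setLIntegral_congr_fun measurableSet_ball fun p hp =>
            slopeOn_congr univ_mem (isOpen_ball.mem_nhds (hlV hp))
              ((hgf n).eventuallyEq_of_mem (isOpen_ball.mem_nhds hp))
      _ ≤ ∫⁻ y in V, slopeOn V (f n) y ∂m := lintegral_mono_set hlV
      _ ≤ c := (hfc n).le
  have hBi := hb.measure_ball_ne_top z δ
  have hlBi := hb.measure_ball_ne_top z (lam * δ)
  have hBl : m (ball z δ) ≤ m (ball z (lam * δ)) := measure_mono (ball_subset_ball hlδ)
  have hP : ∀ n,
      ∫⁻ y in ball z δ, ENNReal.ofReal |g n y - ⨍ w in ball z δ, g n w ∂m| ∂m ≤ q * c := by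
    intro n
    have := h (g n) (hg n) 1 one_pos z δ hδ hδ1
    rw [ENNReal.div_le_iff (h0 z δ hδ) hBi] at this
    refine this.trans ?_
    rw [mul_assoc]
    gcongr
    calc (∫⁻ y in ball z (lam * δ), mSlope (g n) y ∂m) / m (ball z (lam * δ)) * m (ball z δ)
        ≤ c / m (ball z (lam * δ)) * m (ball z (lam * δ)) := by gcongr; exact hslope n
      _ = c := ENNReal.div_mul_cancel (h0 z _ (by nlinarith)) hlBi
  have hlim : Tendsto (fun n => (∫⁻ y in closedBall z δ, ENNReal.ofReal |f n y - charFn E y| ∂m)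
      + q * c) atTop (𝓝 (0 + q * c)) :=
    (hft _ (closedBall_subset_ball (by nlinarith)) (isCompact_closedBall z δ)).add_const _
  rw [zero_add] at hlim
  refine ge_of_tendsto' hlim fun n => ?_
  refine (measure_inter_le_lintegral_abs_sub hE measurableSet_ball hm hBi
    (⨍ w in ball z δ, g n w ∂m)).trans ?_
  refine le_trans ?_ (add_le_add (lintegral_mono_set ball_subset_closedBall) (hP n))
  have hmeas : AEMeasurable (fun y => ENNReal.ofReal |f n y - charFn E y|)
      (m.restrict (ball z δ)) :=
    aemeasurable_ofReal_abs_sub measurableSet_ball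
      ((hf n).continuousOn.mono (ball_subset_ball (by nlinarith))) (measurable_charFn hE)
  rw [← lintegral_add_left' hmeas]
  refine setLIntegral_mono' measurableSet_ball fun y hy => ?_
  rw [← ENNReal.ofReal_add (abs_nonneg _) (abs_nonneg _),
    hgf n (ball_subset_ball hlδ hy), abs_sub_comm (f n y)]
  exact ENNReal.ofReal_le_ofReal (abs_sub_le _ _ _)

/-- A local isoperimetric inequality at small scales, for sets of small density. -/
lemma measure_inter_ball_le_per {C : ℝ → ℝ}
    (hD : UnifLocDoublingWith C m) (hm : m ≠ 0) (hb : BoundedlyFinite m) {N : ℝ≥0∞} (hN : N ≠ ∞)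
    {lam q δ ρ ρ' : ℝ} {x : X} (hlam : 1 ≤ lam) (hδ : 0 < δ)
    (hNd : ∀ t, m (ball t (20 * lam * (δ / 4))) ≤ N * m (ball t (δ / 4)))
    (hRI : ∀ z ∈ ball x ρ, 2 * m (E ∩ ball z δ) ≤ m (ball z δ) →
      m (E ∩ ball z δ) ≤ ENNReal.ofReal q * Per m E (ball z (2 * lam * δ)))
    (hρ : ρ + 2 * lam * δ ≤ ρ')
    (hsmall : ∀ z ∈ ball x ρ, 2 * m (E ∩ ball z δ) ≤ m (ball z δ)) :
    m (E ∩ ball x ρ) ≤ ENNReal.ofReal q * (N * Per m E (ball x ρ')) := by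
  rcases (ball x ρ).eq_empty_or_nonempty with he | hne
  · simp [he]
  have hρ0 := pos_of_mem_ball hne.some_mem
  have hN0 : N ≠ 0 := by
    rintro rfl
    have := hNd x
    rw [zero_mul, nonpos_iff_eq_zero] at this
    exact hD.measure_ball_ne_zero hm x (by positivity) this
  obtain ⟨K, hK, hKx⟩ := hD.exists_ball_le (r := δ / 2 / 2) (by positivity) (2 * ρ + δ / 2)
  have hsub : ∀ z ∈ ball x ρ, ball x (ρ + δ / 2) ⊆ ball z (2 * ρ + δ / 2) := fun z hz => by
    refine ball_subset_ball' ?_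
    rw [dist_comm]
    linarith [mem_ball.1 hz]
  obtain ⟨T, hTx, hTs, hT⟩ := exists_finset_net (m := m) (p := x) (R := ρ) (δ := δ / 2) hK
    (by positivity) (fun z hz => (measure_mono (hsub z hz)).trans (hKx z))
    (hD.measure_ball_ne_zero hm x (by positivity)) (hb.measure_ball_ne_top x _)
  have hsum : ∑ t ∈ T, Per m E (ball t (2 * lam * δ)) ≤ N * Per m E (ball x ρ') := by
    refine sum_per_le_mul hN0 hN (fun _ _ => isOpen_ball)
      (fun t ht => ball_subset_ball' ?_) (fun p _ => ?_) isOpen_ball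
    · linarith [mem_ball.1 (hTx t ht)]
    · classical
      have h1 : ∑ t ∈ T, (ball t (2 * lam * δ)).indicator (fun _ => (1 : ℝ≥0∞)) p =
          ((T.filter fun t => dist t p < 2 * lam * δ).card : ℝ≥0∞) := by
        rw [Finset.card_filter, Nat.cast_sum]
        refine Finset.sum_congr rfl fun t _ => ?_
        simp [indicator_apply, mem_ball, dist_comm]
      rw [h1]
      refine card_le_of_separated (m := m) (p := p) (R := 2 * lam * δ) (δ := δ / 2)
        (fun s hs t ht => hTs s (Finset.mem_filter.1 hs).1 t (Finset.mem_filter.1 ht).1)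
        (by positivity) (fun t ht => (Finset.mem_filter.1 ht).2) (fun t ht => ?_)
        (hD.measure_ball_ne_zero hm p (by positivity)) (hb.measure_ball_ne_top p _)
      have h2 := (Finset.mem_filter.1 ht).2
      have h3 : δ / 2 / 2 = δ / 4 := by ring
      rw [h3]
      refine (measure_mono (ball_subset_ball' ?_)).trans (hNd t)
      rw [dist_comm]
      nlinarith
  calc m (E ∩ ball x ρ) ≤ m (⋃ t ∈ T, E ∩ ball t δ) := by
        refine measure_mono fun z hz => ?_
        obtain ⟨t, ht, hzt⟩ := hT z hz.2
        exact mem_biUnion ht ⟨hz.1, mem_ball.2 (by linarith)⟩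
    _ ≤ ∑ t ∈ T, m (E ∩ ball t δ) := measure_biUnion_finset_le _ _
    _ ≤ ∑ t ∈ T, ENNReal.ofReal q * Per m E (ball t (2 * lam * δ)) :=
        Finset.sum_le_sum fun t ht => hRI t (hTx t ht) (hsmall t (hTx t ht))
    _ ≤ _ := by rw [← Finset.mul_sum]; gcongr

end Isoperimetric

section Decay

variable [MetricSpace X] [MeasurableSpace X] [BorelSpace X] [ProperSpace X] {m : Measure X}

/-- De Giorgi iteration: a Caccioppoli type estimate in the ball of radius `r` and small density
imply that the set is negligible in the ball of radius `r / 2`. -/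
lemma exists_density_threshold {D C : ℝ → ℝ} {lam : ℝ} (hD : UnifLocDoublingWith D m)
    (hm : m ≠ 0) (hb : BoundedlyFinite m) (hP : WeakPoincareWith lam C m) (hlam : 1 ≤ lam)
    (hC : 0 < C 1) (M : ℝ) :
    ∃ ε : ℝ≥0∞, ε ≠ 0 ∧ ∀ E : Set X, MeasurableSet E → ∀ x r, 0 < r → r < 1 →
      (∀ ρ' ρ, r / 2 ≤ ρ' → ρ' < ρ → ρ ≤ r →
        Per m E (ball x ρ') ≤ ENNReal.ofReal (M / (ρ - ρ')) * m (E ∩ ball x ρ)) →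
      m (E ∩ ball x r) ≤ ε * m (ball x r) → m (E ∩ ball x (r / 2)) = 0 := by
  have h0 : ∀ x r, 0 < r → m (ball x r) ≠ 0 := fun x r hr => hD.measure_ball_ne_zero hm x hr
  obtain ⟨K, hK, hKx⟩ := hD.exists_ball_mul_le 2 2
  obtain ⟨N, hN, hNx⟩ := hD.exists_ball_mul_le (20 * lam) 1
  set A := max K 2 with hA
  have hA2 : 2 ≤ A := le_max_right _ _
  have hAi : A ≠ ∞ := (max_lt hK.lt_top (by simp)).ne
  have hA0 : A ≠ 0 := fun h => by simp [h] at hA2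
  have hAj : ∀ (z : X) (j : ℕ) (s : ℝ), 0 < s → 2 ^ j * s ≤ 2 →
      m (ball z (2 ^ j * s)) ≤ A ^ j * m (ball z s) := by
    intro z j
    induction j with
    | zero => intro s _ _; simp
    | succ j ih =>
      intro s hs hs2
      have h1 : (1 : ℝ) ≤ 2 ^ j := one_le_pow₀ one_le_two
      rw [pow_succ, mul_assoc] at hs2
      calc m (ball z (2 ^ (j + 1) * s)) = m (ball z (2 ^ j * (2 * s))) := by ring_nf
        _ ≤ A ^ j * m (ball z (2 * s)) := ih _ (by positivity) hs2
        _ ≤ A ^ j * (A * m (ball z s)) := by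
          gcongr
          exact (hKx z s hs (by nlinarith)).trans (by gcongr; exact le_max_left _ _)
        _ = _ := by ring
  obtain ⟨a, ha0, ha⟩ : ∃ a : ℝ, 0 ≤ a ∧ A * N = ENNReal.ofReal a :=
    ⟨(A * N).toReal, toReal_nonneg, (ofReal_toReal (mul_ne_top hAi hN)).symm⟩
  obtain ⟨p, hp⟩ := pow_unbounded_of_one_lt (max (16 * lam) (a * C 1 * M * 8)) one_lt_two
  have hp1 := (le_max_left _ _).trans hp.le
  have hp2 := (le_max_right _ _).trans hp.le
  have hAp : 2 * A ^ (p + 1) ≠ 0 := mul_ne_zero two_ne_zero (pow_ne_zero _ hA0)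
  have hApi : 2 * A ^ (p + 1) ≠ ∞ := mul_ne_top ofNat_ne_top (pow_ne_top hAi)
  refine ⟨(2 * A ^ (p + 1))⁻¹, ENNReal.inv_ne_zero.2 hApi, fun E hE x r hr hr1 hcac hdens => ?_⟩
  set ε := (2 * A ^ (p + 1))⁻¹ with hε
  have hεA : 2 * A ^ (p + 1) * ε = 1 := ENNReal.mul_inv_cancel hAp hApi
  set R : ℕ → ℝ := fun k => r / 2 + r / 2 ^ (k + 1) with hR
  have hmain : ∀ k, A ^ k * m (E ∩ ball x (R k)) ≤ ε * m (ball x r) := by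
    intro k
    induction k with
    | zero => simpa [hR] using hdens
    | succ k ih =>
      set δ := r / 2 ^ (k + p) with hδ
      have hδ0 : 0 < δ := by positivity
      have hδr : δ ≤ r := div_le_self hr.le (one_le_pow₀ one_le_two)
      set w := r / 2 ^ (k + 3) with hw
      have hw0 : 0 < w := by positivity
      have hRk : R k = R (k + 1) + 2 * w := by
        simp only [hR, hw, pow_succ]; field_simp; ring
      have hRr : R k ≤ r := by
        have : r / 2 ^ (k + 1) ≤ r / 2 :=
          div_le_div_of_nonneg_left hr.le two_pos (by
            rw [pow_succ]; linarith [one_le_pow₀ (n := k) (one_le_two (α := ℝ))])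
        simp only [hR]; linarith
      have hδw : 2 ^ p * δ = 8 * w := by
        simp only [hδ, hw, pow_add]; field_simp; norm_num
      have hlδ : 2 * lam * δ ≤ w := by nlinarith
      have hR1 : r / 2 ≤ R (k + 1) := by
        have : 0 < r / 2 ^ (k + 1 + 1) := by positivity
        simp only [hR]; linarith
      have hsmall : ∀ z ∈ ball x (R (k + 1)), 2 * m (E ∩ ball z δ) ≤ m (ball z δ) := by
        intro z hz
        have hz' := mem_ball.1 hz
        have h1 : m (E ∩ ball z δ) ≤ m (E ∩ ball x (R k)) :=
          measure_mono (inter_subset_inter_right _ (ball_subset_ball' (by nlinarith)))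
        have h2 : m (ball x r) ≤ A ^ (k + p + 1) * m (ball z δ) := by
          have h3 : 2 ^ (k + p + 1) * δ = 2 * r := by
            simp only [hδ, pow_succ]; field_simp
          have := hAj z (k + p + 1) δ hδ0 (by linarith)
          rw [h3] at this
          refine (measure_mono (ball_subset_ball' ?_)).trans this
          rw [dist_comm]; linarith
        have h4 : A ^ k * (2 * m (E ∩ ball z δ)) ≤ A ^ k * m (ball z δ) := by
          calc A ^ k * (2 * m (E ∩ ball z δ)) ≤ 2 * (A ^ k * m (E ∩ ball x (R k))) := by
                rw [mul_left_comm]; gcongr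
            _ ≤ 2 * (ε * (A ^ (k + p + 1) * m (ball z δ))) := by
                exact mul_le_mul_right (ih.trans (by gcongr)) _
            _ = (2 * A ^ (p + 1) * ε) * (A ^ k * m (ball z δ)) := by ring
            _ = _ := by rw [hεA, one_mul]
        exact (ENNReal.mul_le_mul_iff_right (pow_ne_zero _ hA0) (pow_ne_top hAi)).1 h4
      have hiso := measure_inter_ball_le_per (E := E) (x := x) (q := C 1 * δ) (ρ := R (k + 1))
        (ρ' := R (k + 1) + w) hD hm hb hN hlam hδ0
        (fun t => hNx t _ (by positivity) (by linarith))
        (fun z _ hz => hP.measure_inter_le hlam hC hb h0 hE hδ0 (by linarith) hz)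
        (by linarith) hsmall
      have hc := hcac (R (k + 1) + w) (R k) (by linarith) (by linarith) hRr
      have hstep : A * m (E ∩ ball x (R (k + 1))) ≤ m (E ∩ ball x (R k)) := by
        calc A * m (E ∩ ball x (R (k + 1)))
            ≤ A * (ENNReal.ofReal (C 1 * δ) * (N * (ENNReal.ofReal (M / (R k - (R (k + 1) + w)))
                * m (E ∩ ball x (R k))))) := by
              gcongr; exact hiso.trans (by gcongr)
          _ = (A * N) * ENNReal.ofReal (C 1 * δ) * ENNReal.ofReal (M / (R k - (R (k + 1) + w)))
                * m (E ∩ ball x (R k)) := by ring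
          _ ≤ 1 * m (E ∩ ball x (R k)) := by
              gcongr
              have h5 : R k - (R (k + 1) + w) = w := by linarith
              rw [ha, h5, ← ofReal_mul ha0, ← ofReal_mul (by positivity), ofReal_le_one,
                mul_div_assoc', div_le_one hw0]
              have h6 : (a * C 1 * M * 8) * δ ≤ 2 ^ p * δ := by gcongr
              nlinarith
          _ = _ := one_mul _
      calc A ^ (k + 1) * m (E ∩ ball x (R (k + 1)))
          = A ^ k * (A * m (E ∩ ball x (R (k + 1)))) := by ring
        _ ≤ A ^ k * m (E ∩ ball x (R k)) := by gcongr
        _ ≤ _ := ih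
  by_contra hne
  have hεi : ε ≠ ∞ := ENNReal.inv_ne_top.2 hAp
  obtain ⟨n, hn⟩ := exists_nat_mul_gt hne (mul_ne_top hεi (hb.measure_ball_ne_top x r))
  refine absurd (hmain n) (not_le.2 (hn.trans_le ?_))
  have h1 : (n : ℝ≥0∞) ≤ A ^ n := by
    calc (n : ℝ≥0∞) ≤ 2 ^ n := by exact_mod_cast Nat.lt_two_pow_self.le
      _ ≤ A ^ n := by gcongr
  gcongr
  have : 0 < r / 2 ^ (n + 1) := by positivity
  simp only [hR]; linarith

end Decay

section Length

variable [MetricSpace X]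

lemma IsLengthSpace.exists_ball_subset (h : IsLengthSpace X) {x y : X} {s : ℝ} (hs : 0 < s)
    (hsd : s ≤ dist x y) : ∃ p, ball p (s / 4) ⊆ ball x (dist x y) ∩ ball y s := by
  have hlt : ENNReal.ofReal (dist x y) < ENNReal.ofReal (dist x y + s / 4) :=
    (ENNReal.ofReal_lt_ofReal_iff (by positivity)).2 (by linarith)
  rw [h x y] at hlt
  simp only [iInf_lt_iff] at hlt
  obtain ⟨γ, hγ, hγ0, hγ1, hlen⟩ := hlt
  have hc : ContinuousOn (fun t => dist (γ t) y) (Icc 0 1) :=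
    continuous_id.dist continuous_const |>.comp_continuousOn hγ
  obtain ⟨τ, hτ, hτd⟩ : s / 2 ∈ (fun t => dist (γ t) y) '' Icc 0 1 :=
    intermediate_value_Icc' zero_le_one hc
      ⟨by simp only [hγ1, dist_self]; positivity, by simp only [hγ0]; linarith⟩
  have hsum : dist x (γ τ) + dist (γ τ) y < dist x y + s / 4 := by
    rw [← ENNReal.ofReal_lt_ofReal_iff (by positivity),
      ENNReal.ofReal_add dist_nonneg dist_nonneg, ← edist_dist, ← edist_dist]
    refine lt_of_le_of_lt ?_ hlen
    have := eVariationOn.Icc_add_Icc γ hτ.1 hτ.2 (s := univ) (mem_univ τ)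
    simp only [univ_inter] at this
    rw [← this]
    refine add_le_add ?_ ?_
    · have := eVariationOn.edist_le γ (left_mem_Icc.2 hτ.1) (right_mem_Icc.2 hτ.1)
      rwa [hγ0] at this
    · have := eVariationOn.edist_le γ (left_mem_Icc.2 hτ.2) (right_mem_Icc.2 hτ.2)
      rwa [hγ1] at this
  simp only at hτd
  refine ⟨γ τ, subset_inter (ball_subset_ball' ?_) (ball_subset_ball' ?_)⟩
  · rw [dist_comm (γ τ)]; linarith
  · linarith

variable [MeasurableSpace X] [BorelSpace X] {m : Measure X}

/-- Spheres in length spaces are negligible for doubling measures. -/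
lemma IsLengthSpace.measure_sphere [SecondCountableTopology X] {D : ℝ → ℝ}
    (h : IsLengthSpace X) (hD : UnifLocDoublingWith D m) (hm : m ≠ 0) (hb : BoundedlyFinite m)
    (x : X) {t : ℝ} (ht : 0 < t) : m (sphere x t) = 0 := by
  have hae := hD.ae_mem_essExt hm hb (E := ball x t) measurableSet_ball
  refine measure_mono_null (fun y hy => ?_) (ae_iff.1 hae)
  have hxy : dist x y = t := by rw [dist_comm]; exact hy
  have hyn : y ∉ ball x t := by simp [mem_ball, dist_comm y x, hxy]
  simp only [mem_ofPred_eq, Classical.not_imp]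
  refine ⟨hyn, fun hext => ?_⟩
  obtain ⟨K, hK, hKx⟩ := hD.exists_ball_mul_le 8 1
  have hK0 : 2 * K ≠ ∞ := mul_ne_top ofNat_ne_top hK
  obtain ⟨r₀, hr₀, hr⟩ := measure_inter_le_of_mem_essExt hext (ε := (2 * K)⁻¹)
    (ENNReal.inv_ne_zero.2 hK0) (fun r hr => hD.measure_ball_ne_zero hm y hr)
    (hb.measure_ball_ne_top y)
  set s := min (r₀ / 2) (min t 4)
  have hs0 : 0 < s := by positivity
  have hs1 : s < r₀ := (min_le_left _ _).trans_lt (by linarith)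
  have hs2 : s ≤ t := (min_le_right _ _).trans (min_le_left _ _)
  have hs3 : s ≤ 4 := (min_le_right _ _).trans (min_le_right _ _)
  obtain ⟨p, hp⟩ := h.exists_ball_subset hs0 (hs2.trans_eq hxy.symm)
  rw [hxy] at hp
  have hpy : dist y p < s := by
    rw [dist_comm]; exact (hp (mem_ball_self (by positivity))).2
  have hp0 := hD.measure_ball_ne_zero hm p (show 0 < s / 4 by positivity)
  have h1 : m (ball y s) ≤ K * m (ball p (s / 4)) := by
    refine (measure_mono (ball_subset_ball' ?_)).trans (hKx p (s / 4) (by positivity) (by linarith))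
    linarith
  have h2 : m (ball p (s / 4)) ≤ (2 * K)⁻¹ * m (ball y s) := (measure_mono hp).trans (hr s hs0 hs1)
  have h3 : 2 * m (ball p (s / 4)) ≤ 1 * m (ball p (s / 4)) := by
    calc 2 * m (ball p (s / 4)) ≤ 2 * ((2 * K)⁻¹ * (K * m (ball p (s / 4)))) := by
          gcongr; exact h2.trans (by gcongr)
      _ = (2 * K) * (2 * K)⁻¹ * m (ball p (s / 4)) := by ring
      _ ≤ 1 * m (ball p (s / 4)) := by gcongr; exact ENNReal.mul_inv_le_one _
  rw [ENNReal.mul_le_mul_iff_left hp0 (hb.measure_ball_ne_top _ _)] at h3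
  norm_num at h3

/-- In a length space the measure of `A ∩ ball y s` depends continuously on `s`. -/
lemma exists_measure_inter_ball_eq {A : Set X} {y : X} {a b : ℝ} (hA : MeasurableSet A)
    (hb : BoundedlyFinite m) (ha : 0 < a) (hab : a ≤ b) (hsph : ∀ t, 0 < t → m (sphere y t) = 0)
    {v : ℝ≥0∞} (hav : m (A ∩ ball y a) ≤ v) (hvb : v ≤ m (A ∩ ball y b)) :
    ∃ s, a ≤ s ∧ s ≤ b ∧ m (A ∩ ball y s) = v := by
  set w : ℝ → ℝ≥0∞ := fun t => m (A ∩ ball y t)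
  have hw : Monotone w := fun s t hst =>
    measure_mono (inter_subset_inter_right _ (ball_subset_ball hst))
  set S := {t | t ∈ Icc a b ∧ w t ≤ v}
  have hSb : BddAbove S := ⟨b, fun t ht => ht.1.2⟩
  have haS : a ∈ S := ⟨left_mem_Icc.2 hab, hav⟩
  set s := sSup S
  have has : a ≤ s := le_csSup hSb haS
  have hsb : s ≤ b := csSup_le ⟨a, haS⟩ fun t ht => ht.1.2
  refine ⟨s, has, hsb, le_antisymm ?_ ?_⟩
  · obtain ⟨u, hu, hus, hut⟩ := exists_seq_strictMono_tendsto s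
    have h1 : A ∩ ball y s = ⋃ n, A ∩ ball y (u n) := by
      rw [← inter_iUnion]
      congr 1
      refine subset_antisymm (fun z hz => ?_) (iUnion_subset fun n => ball_subset_ball (hus n).le)
      obtain ⟨n, hn⟩ := (hut.eventually_const_lt (mem_ball.1 hz)).exists
      exact mem_iUnion.2 ⟨n, hn⟩
    rw [h1, Monotone.measure_iUnion fun i j hij =>
      inter_subset_inter_right _ (ball_subset_ball (hu.monotone hij))]
    refine iSup_le fun n => ?_
    obtain ⟨t, ht, htn⟩ := exists_lt_of_lt_csSup ⟨a, haS⟩ (hus n)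
    exact (hw htn.le).trans ht.2
  · rcases hsb.eq_or_lt with heq | hlt
    · rw [heq]; exact hvb
    obtain ⟨u, hu, hus, hut⟩ := exists_seq_strictAnti_tendsto' hlt
    have h1 : A ∩ closedBall y s = ⋂ n, A ∩ ball y (u n) := by
      rw [← inter_iInter]
      congr 1
      refine subset_antisymm (subset_iInter fun n => closedBall_subset_ball (hus n).1)
        fun z hz => ?_
      exact ge_of_tendsto' hut fun n => (mem_ball.1 (mem_iInter.1 hz n)).le
    have h2 : m (A ∩ closedBall y s) ≤ w s := by
      have h3 : A ∩ closedBall y s ⊆ (A ∩ ball y s) ∪ sphere y s := by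
        rw [← ball_union_sphere, inter_union_distrib_left]
        exact union_subset_union_right _ inter_subset_right
      refine (measure_mono h3).trans ((measure_union_le _ _).trans ?_)
      rw [hsph s (ha.trans_le has), add_zero]
    refine le_trans ?_ h2
    rw [h1, Antitone.measure_iInter (fun i j hij =>
      inter_subset_inter_right _ (ball_subset_ball (hu.antitone hij)))
      (fun n => (hA.inter measurableSet_ball).nullMeasurableSet)
      ⟨0, measure_ne_top_of_subset inter_subset_right (hb.measure_ball_ne_top y _)⟩]
    refine le_iInf fun n => ?_
    by_contra! hcon
    exact absurd (le_csSup hSb ⟨⟨has.trans (hus n).1.le, (hus n).2.le⟩, hcon.le⟩)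
      (not_le.2 (hus n).1)

end Length

section Competitor

variable [MetricSpace X] [ProperSpace X] [MeasurableSpace X] [BorelSpace X] {m : Measure X}
  {E F Ω : Set X} {x y y' : X}

/-- Comparison of a volume-constrained minimizer with a competitor which differs from it only
inside two disjoint balls. -/
lemma per_add_per_le_of_minimizer (hE : MeasurableSet E) (hEp : HasLocFinPer m E)
    (hmin : ∀ F K : Set X, MeasurableSet F → IsCompact K → K ⊆ Ω →
      m ((E ∆ F) \ K) = 0 → m (E ∩ K) = m (F ∩ K) → Per m E K ≤ Per m F K)
    (hF : MeasurableSet F) {r r' ρ₁ L L' ρ₂ : ℝ}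
    (hd : r' + L' ≤ dist x y) (hx : closedBall x ρ₁ ⊆ Ω) (hy : closedBall y ρ₂ ⊆ Ω)
    (hr : r < ρ₁) (hr' : ρ₁ < r') (hL : L < ρ₂) (hL' : ρ₂ < L')
    (hG₁ : GoodRadius m E x ρ₁) (hG₂ : GoodRadius m E y ρ₂)
    (hEF : E ∆ F ⊆ closedBall x r ∪ closedBall y L)
    (hvol : m (E ∩ (closedBall x ρ₁ ∪ closedBall y ρ₂)) =
      m (F ∩ (closedBall x ρ₁ ∪ closedBall y ρ₂))) :
    Per m E (ball x ρ₁) + Per m E (ball y ρ₂) ≤ Per m F (ball x ρ₁) + Per m F (ball y ρ₂) := by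
  set K := closedBall x ρ₁ ∪ closedBall y ρ₂ with hK
  have hKc : IsCompact K := (isCompact_closedBall _ _).union (isCompact_closedBall _ _)
  have hEFK : E ∆ F ⊆ K := hEF.trans (union_subset_union (closedBall_subset_closedBall hr.le)
    (closedBall_subset_closedBall hL.le))
  have hcmp : Per m E K ≤ Per m F K := hmin F K hF hKc (union_subset hx hy)
    (by rw [sdiff_eq_empty.2 hEFK, measure_empty]) hvol
  obtain ⟨U₀, -, hKU₀, hU₀f⟩ := hEp.exists_isOpen hE hKc
  have hKf : Per m E K ≠ ∞ := ((per_mono hKU₀).trans_lt hU₀f).ne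
  have hF₁ : GoodRadius m F x ρ₁ := by
    refine hG₁.congr hr hr' ?_
    convert measure_empty (μ := m)
    refine eq_empty_of_forall_notMem fun z hz => ?_
    rcases hEF hz.1 with h | h
    · exact hz.2.2 h
    · have h1 := mem_ball.1 hz.2.1
      have h2 := mem_closedBall.1 h
      have := dist_triangle_left x y z
      linarith
  have hF₂ : GoodRadius m F y ρ₂ := by
    refine hG₂.congr hL hL' ?_
    convert measure_empty (μ := m)
    refine eq_empty_of_forall_notMem fun z hz => ?_
    rcases hEF hz.1 with h | h
    · have h1 := mem_ball.1 hz.2.1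
      have h2 := mem_closedBall.1 h
      have := dist_triangle_left x y z
      linarith
    · exact hz.2.2 h
  refine ENNReal.le_of_forall_pos_le_add fun ε hε _ => ?_
  obtain ⟨U, hU, hKU, hUε⟩ := exists_isOpen_per_lt
    (ENNReal.lt_add_right hKf (b := ε) (by simpa using hε.ne'))
  have hxU : closedBall x ρ₁ ⊆ U := subset_union_left.trans hKU
  have hU' : IsOpen (U \ closedBall x ρ₁) := hU.sdiff isClosed_closedBall
  have hyU : closedBall y ρ₂ ⊆ U \ closedBall x ρ₁ := fun z hz => by
    refine ⟨hKU (Or.inr hz), fun hzx => ?_⟩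
    have h1 := mem_closedBall.1 hz
    have h2 := mem_closedBall.1 hzx
    have := dist_triangle_left x y z
    linarith
  have hW : Per m E ((U \ closedBall x ρ₁) \ closedBall y ρ₂) =
      Per m F ((U \ closedBall x ρ₁) \ closedBall y ρ₂) := by
    refine per_congr (hU'.sdiff isClosed_closedBall) ?_
    convert measure_empty (μ := m)
    refine eq_empty_of_forall_notMem fun z hz => ?_
    rcases hEFK hz.1 with h | h
    · exact hz.2.1.2 h
    · exact hz.2.2 h
  have hUE : Per m E U = Per m E (ball x ρ₁) + Per m E (ball y ρ₂) +
      Per m E ((U \ closedBall x ρ₁) \ closedBall y ρ₂) := by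
    rw [hG₁.per_eq_add hE hU hxU, hG₂.per_eq_add hE hU' hyU, add_assoc]
  have hUF : Per m F U = Per m F (ball x ρ₁) + Per m F (ball y ρ₂) +
      Per m E ((U \ closedBall x ρ₁) \ closedBall y ρ₂) := by
    rw [hW, hF₁.per_eq_add hF hU hxU, hF₂.per_eq_add hF hU' hyU, add_assoc]
  have hUf : Per m E U ≠ ∞ := (hUε.trans_le le_top).ne
  have hWf : Per m E ((U \ closedBall x ρ₁) \ closedBall y ρ₂) ≠ ∞ :=
    ne_top_of_le_ne_top hUf (per_mono (sdiff_subset.trans sdiff_subset))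
  have hfin : Per m E U ≤ Per m F U + ε := hUε.le.trans (by
    gcongr
    exact hcmp.trans (per_mono hKU))
  rw [hUE, hUF, add_right_comm _ _ (ε : ℝ≥0∞)] at hfin
  exact (ENNReal.add_le_add_iff_right hWf).1 hfin

/-- Localization of the deformation inequality. -/
lemma DeformIneq.per_union_ball_le {R C s ρ : ℝ} (h : DeformIneq m E y' R C) (hE : MeasurableSet E)
    (hEp : HasLocFinPer m E) (hy : y ∈ ball y' R) (hs : 0 < s) (hsρ : s < ρ) (hρ : ρ < R)
    (hG : GoodRadius m E y ρ) :
    Per m (E ∪ ball y s) (ball y ρ) ≤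
      ENNReal.ofReal C * m (ball y s \ E) / ENNReal.ofReal s + Per m E (ball y ρ) := by
  set V := ball y' (2 * R) with hV
  obtain ⟨U₀, -, hKU₀, hU₀f⟩ := hEp.exists_isOpen hE (isCompact_closedBall y' (2 * R))
  have hVf : Per m E V ≠ ∞ :=
    ((per_mono (ball_subset_closedBall.trans hKU₀)).trans_lt hU₀f).ne
  have hyV : closedBall y ρ ⊆ V := by
    refine closedBall_subset_ball' ?_
    linarith [mem_ball.1 hy]
  have hd : E ∆ (E ∪ ball y s) ⊆ closedBall y s := by
    intro z hz
    rcases hz with hz | hz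
    · exact absurd (Or.inl hz.1) hz.2
    · exact ball_subset_closedBall (hz.1.resolve_left hz.2)
  have hG' : GoodRadius m (E ∪ ball y s) y ρ := by
    refine hG.congr hsρ (lt_add_one ρ) ?_
    convert measure_empty (μ := m)
    exact eq_empty_of_forall_notMem fun z hz => hz.2.2 (hd hz.1)
  have h1 := (h y hy s ⟨hs, hsρ.trans hρ⟩).2
  have hW : Per m E (V \ closedBall y ρ) = Per m (E ∪ ball y s) (V \ closedBall y ρ) := by
    refine per_congr (isOpen_ball.sdiff isClosed_closedBall) ?_
    convert measure_empty (μ := m)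
    exact eq_empty_of_forall_notMem fun z hz =>
      hz.2.2 (closedBall_subset_closedBall hsρ.le (hd hz.1))
  rw [hG.per_eq_add hE isOpen_ball hyV,
    hG'.per_eq_add (hE.union measurableSet_ball) isOpen_ball hyV,
    ← hW, ← add_assoc] at h1
  exact (ENNReal.add_le_add_iff_right (ne_top_of_le_ne_top hVf (per_mono sdiff_subset))).1 h1

/-- Caccioppoli type estimate for volume-constrained minimizers: the mass removed near `x` is
restored near `y`. -/
lemma per_ball_le_of_minimizer (hE : MeasurableSet E) (hEp : HasLocFinPer m E)
    (hmin : ∀ F K : Set X, MeasurableSet F → IsCompact K → K ⊆ Ω →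
      m ((E ∆ F) \ K) = 0 → m (E ∩ K) = m (F ∩ K) → Per m E K ≤ Per m F K)
    (hb : BoundedlyFinite m) (hsph : ∀ t, 0 < t → m (sphere y t) = 0)
    {r r' ℓ L L' R C : ℝ} (hd : r' + L' ≤ dist x y) (hx : closedBall x r' ⊆ Ω)
    (hy : closedBall y L' ⊆ Ω) (hr : r < r') (hℓ : 0 < ℓ) (hℓL : ℓ ≤ L)
    (hL : L < L') (hLR : L' ≤ R) (hdef : DeformIneq m E y' R C) (hyy : y ∈ ball y' R)
    (hvℓ : m (ball y ℓ \ E) ≤ m (E ∩ ball x (r / 2))) (hvL : m (E ∩ ball x r) ≤ m (ball y L \ E))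
    (hpos : m (E ∩ ball x (r / 2)) ≠ 0) {ρ ρ' : ℝ} (hρ' : r / 2 ≤ ρ') (hρ : ρ' < ρ) (hρr : ρ ≤ r) :
    Per m E (ball x ρ') ≤
      (ENNReal.ofReal (4 / (ρ - ρ')) + ENNReal.ofReal (C / ℓ)) * m (E ∩ ball x ρ) := by
  have hfx : Per m E (ball x r') < ∞ := by
    obtain ⟨U₀, -, hKU₀, hU₀f⟩ := hEp.exists_isOpen hE (isCompact_closedBall x r')
    exact (per_mono (ball_subset_closedBall.trans hKU₀)).trans_lt hU₀f
  have hfy : Per m E (ball y L') < ∞ := by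
    obtain ⟨U₀, -, hKU₀, hU₀f⟩ := hEp.exists_isOpen hE (isCompact_closedBall y L')
    exact (per_mono (ball_subset_closedBall.trans hKU₀)).trans_lt hU₀f
  obtain ⟨ρ₁, hrρ₁, hρ₁r', hG₁⟩ := exists_goodRadius hr hfx
  obtain ⟨ρ₂, hLρ₂, hρ₂L', hG₂⟩ := exists_goodRadius hL hfy
  have hf₁ : Per m E (ball x ρ₁) ≠ ∞ := ((per_mono (ball_subset_ball hρ₁r'.le)).trans_lt hfx).ne
  have hf₂ : Per m E (ball y ρ₂) ≠ ∞ := ((per_mono (ball_subset_ball hρ₂L'.le)).trans_lt hfy).ne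
  have hmono : ∀ {s t : ℝ}, s ≤ t → m (E ∩ ball x s) ≤ m (E ∩ ball x t) := fun hst =>
    measure_mono (inter_subset_inter_right _ (ball_subset_ball hst))
  obtain ⟨t, htρ', htρ, hcut⟩ := exists_cut (m := m) (U := ball x ρ₁) isOpen_ball hE hρ
    (closedBall_subset_ball (by linarith)) hf₁.lt_top
    (fun h0 => hpos (le_antisymm ((hmono (by linarith)).trans h0.le) zero_le))
    (hb.measure_ball_ne_top x ρ)
  have hv : m (E ∩ closedBall x t) ≤ m (E ∩ ball x ρ) :=
    measure_mono (inter_subset_inter_right _ (closedBall_subset_ball htρ))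
  have hcompl : ∀ s, Eᶜ ∩ ball y s = ball y s \ E := fun s => by rw [inter_comm, sdiff_eq]
  obtain ⟨s, hℓs, hsL, hs⟩ := exists_measure_inter_ball_eq (m := m) (A := Eᶜ) (y := y)
    (v := m (E ∩ closedBall x t)) hE.compl hb hℓ hℓL hsph
    (by
      rw [hcompl]
      exact hvℓ.trans (measure_mono (inter_subset_inter_right _
        ((ball_subset_ball (by linarith)).trans ball_subset_closedBall))))
    (by
      rw [hcompl]
      exact hv.trans ((hmono hρr).trans hvL))
  rw [hcompl] at hs
  have hs0 : 0 < s := hℓ.trans_le hℓs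
  have hfar : ∀ z, dist z x < r' → dist z y < L' → False := fun z h1 h2 => by
    have := dist_triangle_left x y z
    linarith
  set F := (E \ closedBall x t) ∪ ball y s with hF
  have hFm : MeasurableSet F := (hE.diff measurableSet_closedBall).union measurableSet_ball
  have hcomp := per_add_per_le_of_minimizer (F := F) (r := r) (L := L) hE hEp hmin hFm hd
    ((closedBall_subset_closedBall hρ₁r'.le).trans hx)
    ((closedBall_subset_closedBall hρ₂L'.le).trans hy) hrρ₁ hρ₁r' hLρ₂ hρ₂L' hG₁ hG₂ ?_ ?_
  · have hF₁ : Per m F (ball x ρ₁) = Per m (E \ closedBall x t) (ball x ρ₁) := by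
      refine per_congr isOpen_ball ?_
      convert measure_empty (μ := m)
      refine eq_empty_of_forall_notMem fun z hz => ?_
      rcases hz.1 with h | h
      · exact hfar z ((mem_ball.1 hz.2).trans hρ₁r')
          ((mem_ball.1 (h.1.resolve_left h.2)).trans_le (by linarith))
      · exact h.2 (Or.inl h.1)
    have hF₂ : Per m F (ball y ρ₂) = Per m (E ∪ ball y s) (ball y ρ₂) := by
      refine per_congr isOpen_ball ?_
      convert measure_empty (μ := m)
      refine eq_empty_of_forall_notMem fun z hz => ?_
      have hzy := (mem_ball.1 hz.2).trans hρ₂L'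
      rcases hz.1 with h | h
      · exact h.2 (h.1.imp_left fun h => h.1)
      · refine h.2 (h.1.imp_left fun hzE => ⟨hzE, fun hzt => ?_⟩)
        exact hfar z ((mem_closedBall.1 hzt).trans_lt (by linarith)) hzy
    have hdf := hdef.per_union_ball_le hE hEp hyy hs0 (hsL.trans_lt hLρ₂) (by linarith) hG₂
    rw [hs] at hdf
    rw [hF₁, hF₂] at hcomp
    have h1 : Per m E (ball x ρ₁) ≤ Per m (E \ closedBall x t) (ball x ρ₁) +
        ENNReal.ofReal C * m (E ∩ closedBall x t) / ENNReal.ofReal s := by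
      refine (ENNReal.add_le_add_iff_right hf₂).1 (hcomp.trans ?_)
      rw [add_assoc]
      gcongr
    have h2 : ENNReal.ofReal C * m (E ∩ closedBall x t) / ENNReal.ofReal s ≤
        ENNReal.ofReal (C / ℓ) * m (E ∩ ball x ρ) := by
      rw [ENNReal.ofReal_div_of_pos hℓ, ENNReal.mul_div_right_comm]
      gcongr
    have h3 : Per m E (ball x ρ₁) + Per m E (ball x ρ') ≤ Per m E (ball x ρ₁) +
        (ENNReal.ofReal (4 / (ρ - ρ')) + ENNReal.ofReal (C / ℓ)) * m (E ∩ ball x ρ) := by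
      calc Per m E (ball x ρ₁) + Per m E (ball x ρ')
          ≤ Per m (E \ closedBall x t) (ball x ρ₁) +
              ENNReal.ofReal (C / ℓ) * m (E ∩ ball x ρ) + Per m E (ball x ρ') := by
            gcongr; exact h1.trans (by gcongr)
        _ = Per m (E \ closedBall x t) (ball x ρ₁) + Per m E (ball x ρ') +
              ENNReal.ofReal (C / ℓ) * m (E ∩ ball x ρ) := add_right_comm _ _ _
        _ ≤ Per m E (ball x ρ₁) + ENNReal.ofReal (4 / (ρ - ρ')) * m (E ∩ ball x ρ) +
              ENNReal.ofReal (C / ℓ) * m (E ∩ ball x ρ) := by gcongr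
        _ = _ := by ring
    exact (ENNReal.add_le_add_iff_left hf₁).1 h3
  · rintro z (h | h)
    · left
      by_contra hz
      exact h.2 (Or.inl ⟨h.1, fun hzt => hz (closedBall_subset_closedBall (by linarith) hzt)⟩)
    · rcases h.1 with h' | h'
      · exact absurd h'.1 h.2
      · exact Or.inr (ball_subset_closedBall (ball_subset_ball hsL h'))
  · set K := closedBall x ρ₁ ∪ closedBall y ρ₂
    have hsub₁ : closedBall x t ⊆ K :=
      (closedBall_subset_closedBall (by linarith)).trans subset_union_left
    have hsub₂ : ball y s ⊆ K :=
      (ball_subset_closedBall.trans (closedBall_subset_closedBall (by linarith))).trans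
        subset_union_right
    rw [← measure_inter_add_sdiff (E ∩ K) (measurableSet_closedBall (x := x) (ε := t)),
      ← measure_inter_add_sdiff (F ∩ K) (measurableSet_ball.diff hE : MeasurableSet (ball y s \ E))]
    congr 1
    · rw [show E ∩ K ∩ closedBall x t = E ∩ closedBall x t by grind,
        show F ∩ K ∩ (ball y s \ E) = ball y s \ E by grind, hs]
    · congr 1
      ext z
      have := hfar z
      have h1 : z ∈ closedBall x t → z ∈ ball y s → False := fun h h' =>
        this ((mem_closedBall.1 h).trans_lt (by linarith)) ((mem_ball.1 h').trans_le (by linarith))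
      simp only [hF, Set.mem_sdiff, mem_inter_iff, mem_union]
      tauto

end Competitor

section Regularity

variable [MetricSpace X] [MeasurableSpace X] {m : Measure X} {E Ω : Set X}

/-- `E` has locally finite perimeter and minimizes the perimeter in `Ω` under a volume
constraint. -/
structure IsVolConstMinIn (m : Measure X) (Ω E : Set X) : Prop where
  measurableSet : MeasurableSet E
  hasLocFinPer : HasLocFinPer m E
  per_le : ∀ F K : Set X, MeasurableSet F → IsCompact K → K ⊆ Ω →
    m ((E ∆ F) \ K) = 0 → m (E ∩ K) = m (F ∩ K) → Per m E K ≤ Per m F K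

lemma IsVolConstMinIn.compl [OpensMeasurableSpace X] (h : IsVolConstMinIn m Ω E)
    (hb : BoundedlyFinite m) : IsVolConstMinIn m Ω Eᶜ where
  measurableSet := h.measurableSet.compl
  hasLocFinPer x := by simpa only [per_compl] using h.hasLocFinPer x
  per_le F K hF hK hKΩ hd hv := by
    have hKf : m K ≠ ∞ := (hb K hK.isBounded).ne
    have hv' : ∀ A : Set X, MeasurableSet A → m (A ∩ K) = m K - m (Aᶜ ∩ K) := fun A hA => by
      rw [← measure_inter_add_sdiff K hA, sdiff_eq, inter_comm K Aᶜ, inter_comm K A,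
        ENNReal.add_sub_cancel_right (measure_ne_top_of_subset inter_subset_right hKf)]
    have h1 := h.per_le Fᶜ K hF.compl hK hKΩ
      (by rwa [← compl_symmDiff_compl, compl_compl])
      (by rw [hv' E h.measurableSet, hv' Fᶜ hF.compl, compl_compl, hv])
    rwa [per_compl, ← per_compl F]

lemma exists_radius_of_mem_essExt {x : X} {ε v : ℝ≥0∞} (hx : x ∈ essExt m E)
    (h0 : ∀ r, 0 < r → m (ball x r) ≠ 0) (hi : ∀ r, m (ball x r) ≠ ∞) (hε : ε ≠ 0) (hv : v ≠ 0) :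
    ∃ r₀ > 0, ∀ r, 0 < r → r < r₀ → m (E ∩ ball x r) ≤ ε * m (ball x r) ∧ m (E ∩ ball x r) ≤ v := by
  obtain ⟨r₁, hr₁, h1⟩ := measure_inter_le_of_mem_essExt hx hε h0 hi
  obtain ⟨r₂, hr₂, h2⟩ := measure_inter_le_of_mem_essExt hx (ε := v / m (ball x 1))
    (ENNReal.div_ne_zero.2 ⟨hv, hi 1⟩) h0 hi
  refine ⟨min r₁ (min r₂ 1), by positivity, fun r hr hr' => ?_⟩
  simp only [lt_min_iff] at hr'
  refine ⟨h1 r hr hr'.1, (h2 r hr hr'.2.1).trans ?_⟩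
  calc v / m (ball x 1) * m (ball x r) ≤ v / m (ball x 1) * m (ball x 1) := by
        gcongr; exact hr'.2.2.le
    _ ≤ v := (ENNReal.div_mul_cancel (h0 1 one_pos) (hi 1)).le

lemma notMem_essExt_compl {x : X} (hE : MeasurableSet E) (h0 : ∀ r, 0 < r → m (ball x r) ≠ 0)
    (hi : ∀ r, m (ball x r) ≠ ∞) (hx : x ∈ essExt m E) : x ∉ essExt m Eᶜ := fun h =>
  zero_ne_one (tendsto_nhds_unique hx ((essExt_compl hE h0 hi).1 h))

lemma mem_essExt_of_measure_eq_zero {x : X} {r : ℝ} (hr : 0 < r) (h : m (E ∩ ball x r) = 0) :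
    x ∈ essExt m E := by
  refine tendsto_const_nhds.congr' ?_
  filter_upwards [Ioo_mem_nhdsGT hr] with s hs
  rw [measure_mono_null (inter_subset_inter_right _ (ball_subset_ball hs.2.le)) h, ENNReal.zero_div]

variable [ProperSpace X] [BorelSpace X] {x y y' : X} {D C_P : ℝ → ℝ} {lam : ℝ}

/-- If a minimizer `E` has small density in a ball around `x`, and volume can be added near `y`
at a controlled cost in perimeter, then `E` is negligible near `x`. -/
lemma IsVolConstMinIn.exists_density_threshold (hD : UnifLocDoublingWith D m) (hm : m ≠ 0)
    (hb : BoundedlyFinite m) (hP : WeakPoincareWith lam C_P m) (hlam : 1 ≤ lam) (hC_P : 0 < C_P 1)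
    {C : ℝ} (hC : 0 ≤ C) :
    ∃ ε : ℝ≥0∞, ε ≠ 0 ∧ ∀ (E Ω : Set X) (x y y' : X) (r r' ℓ L L' R : ℝ),
      IsVolConstMinIn m Ω E → (∀ t, 0 < t → m (sphere y t) = 0) → r' + L' ≤ dist x y →
      closedBall x r' ⊆ Ω → closedBall y L' ⊆ Ω → 0 < r → r < 1 → r < r' → r / 2 ≤ ℓ → ℓ ≤ L →
      L < L' → L' ≤ R → DeformIneq m E y' R C → y ∈ ball y' R →
      m (Eᶜ ∩ ball y ℓ) ≤ m (E ∩ ball x (r / 2)) → m (E ∩ ball x r) ≤ m (Eᶜ ∩ ball y L) →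
      m (E ∩ ball x r) ≤ ε * m (ball x r) → m (E ∩ ball x (r / 2)) = 0 := by
  obtain ⟨ε, hε, h⟩ := _root_.exists_density_threshold hD hm hb hP hlam hC_P (4 + C)
  refine ⟨ε, hε, fun E Ω x y y' r r' ℓ L L' R hE hsph hd hx hy hr hr1 hr' hℓ hℓL hL hLR hdef hyy
    hvℓ hvL hden => ?_⟩
  by_contra hpos
  have hcompl : ∀ s, Eᶜ ∩ ball y s = ball y s \ E := fun s => by rw [inter_comm, sdiff_eq]
  rw [hcompl] at hvℓ hvL
  refine hpos (h E hE.measurableSet x r hr hr1 (fun ρ' ρ hρ' hρ hρr => ?_) hden)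
  refine (per_ball_le_of_minimizer hE.measurableSet hE.hasLocFinPer hE.per_le hb hsph hd hx hy hr'
    (by linarith) hℓL hL hLR hdef hyy hvℓ hvL hpos hρ' hρ hρr).trans ?_
  have h1 : 0 < ρ - ρ' := sub_pos.2 hρ
  rw [← ENNReal.ofReal_add (by positivity) (div_nonneg hC (by linarith)), add_div]
  gcongr
  linarith

/-- A minimizer cannot have, at the same time, a point of density zero around which it is not
negligible and a point of density one around which its complement is not negligible. -/
lemma IsVolConstMinIn.exists_measure_eq_zero_or (hE : IsVolConstMinIn m Ω E)
    (hD : UnifLocDoublingWith D m) (hm : m ≠ 0) (hb : BoundedlyFinite m)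
    (hP : WeakPoincareWith lam C_P m) (hlam : 1 ≤ lam) (hC_P : 0 < C_P 1)
    (hlen : IsLengthSpace X) (hdef : DeformationProperty m) (hΩ : IsOpen Ω) (hxΩ : x ∈ Ω)
    (hyΩ : y ∈ Ω) (hx : x ∈ essExt m E) (hy : y ∈ essExt m Eᶜ) :
    (∃ r > 0, m (E ∩ ball x r) = 0) ∨ ∃ r > 0, m (Eᶜ ∩ ball y r) = 0 := by
  have h0 : ∀ z r, 0 < r → m (ball z r) ≠ 0 := fun z r hr => hD.measure_ball_ne_zero hm z hr
  have hi : ∀ z r, m (ball z r) ≠ ∞ := hb.measure_ball_ne_top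
  have hsph := fun z t ht => hlen.measure_sphere hD hm hb z (t := t) ht
  by_contra! hcon
  obtain ⟨hux, huy⟩ := hcon
  have hxy : 0 < dist x y := dist_pos.2 fun h =>
    notMem_essExt_compl hE.measurableSet (h0 x) (hi x) hx (h ▸ hy)
  have hE' := hE.compl hb
  obtain ⟨R, hR, -, C, hC, hdefy⟩ := hdef E hE.measurableSet hE.hasLocFinPer y
  obtain ⟨R', hR', -, C', hC', hdefx⟩ := hdef Eᶜ hE'.measurableSet hE'.hasLocFinPer x
  obtain ⟨ε, hε, hth⟩ := exists_density_threshold hD hm hb hP hlam hC_P hC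
  obtain ⟨ε', hε', hth'⟩ := exists_density_threshold hD hm hb hP hlam hC_P hC'
  obtain ⟨a, ha, hax⟩ := nhds_basis_closedBall.mem_iff.1 (hΩ.mem_nhds hxΩ)
  obtain ⟨b, hb0, hby⟩ := nhds_basis_closedBall.mem_iff.1 (hΩ.mem_nhds hyΩ)
  obtain ⟨δ, hδ, hδle⟩ : ∃ δ > 0, δ ≤ R ∧ δ ≤ R' ∧ δ ≤ a ∧ δ ≤ b ∧ δ ≤ dist x y / 2 :=
    ⟨min R (min R' (min a (min b (dist x y / 2)))), by positivity, by simp⟩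
  obtain ⟨hδR, hδR', hδa, hδb, hδd⟩ := hδle
  obtain ⟨r₁, hr₁, h1⟩ := exists_radius_of_mem_essExt hx (h0 x) (hi x) hε
    (huy (δ / 2) (by positivity))
  obtain ⟨r₂, hr₂, h2⟩ := exists_radius_of_mem_essExt hy (h0 y) (hi y) hε'
    (hux (δ / 2) (by positivity))
  obtain ⟨r, hr, hr'⟩ := exists_between (show 0 < min r₁ (min r₂ (min 1 δ)) by positivity)
  simp only [lt_min_iff] at hr'
  obtain ⟨hrr₁, hrr₂, hr1, hrδ⟩ := hr'
  obtain ⟨h1d, h1v⟩ := h1 r hr hrr₁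
  obtain ⟨h2d, h2v⟩ := h2 r hr hrr₂
  have hxδ := (closedBall_subset_closedBall hδa).trans hax
  have hyδ := (closedBall_subset_closedBall hδb).trans hby
  rcases le_total (m (Eᶜ ∩ ball y (r / 2))) (m (E ∩ ball x (r / 2))) with h | h
  · exact hux (r / 2) (by positivity) (hth E Ω x y y r δ (r / 2) (δ / 2) δ R hE (hsph y)
      (by linarith) hxδ hyδ hr hr1 hrδ le_rfl (by linarith) (by linarith) hδR hdefy
      (mem_ball_self hR) h h1v h1d)
  · refine huy (r / 2) (by positivity) (hth' Eᶜ Ω y x x r δ (r / 2) (δ / 2) δ R' hE' (hsph x)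
      (by rw [dist_comm]; linarith) hyδ hxδ hr hr1 hrδ le_rfl (by linarith) (by linarith) hδR'
      hdefx (mem_ball_self hR') ?_ ?_ h2d)
    · rwa [compl_compl]
    · rwa [compl_compl]

/-- If the complement of a minimizer `E` is negligible around all points of density one,
then `E` is negligible around all points of density zero. -/
lemma IsVolConstMinIn.exists_measure_eq_zero_of_compl (hE : IsVolConstMinIn m Ω E)
    (hD : UnifLocDoublingWith D m) (hm : m ≠ 0) (hb : BoundedlyFinite m)
    (hP : WeakPoincareWith lam C_P m) (hlam : 1 ≤ lam) (hC_P : 0 < C_P 1)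
    (hlen : IsLengthSpace X) (hdef : DeformationProperty m) (hΩ : IsOpen Ω) (hxΩ : x ∈ Ω)
    (hx : x ∈ essExt m E)
    (hcompl : ∀ y ∈ Ω, y ∈ essExt m Eᶜ → ∃ r > 0, m (Eᶜ ∩ ball y r) = 0) :
    ∃ r > 0, m (E ∩ ball x r) = 0 := by
  have h0 : ∀ z r, 0 < r → m (ball z r) ≠ 0 := fun z r hr => hD.measure_ball_ne_zero hm z hr
  have hi : ∀ z r, m (ball z r) ≠ ∞ := hb.measure_ball_ne_top
  by_contra! hux
  obtain ⟨R, hR, hR1, C, hC, hdefx⟩ := hdef E hE.measurableSet hE.hasLocFinPer x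
  obtain ⟨ε, hε, hth⟩ := exists_density_threshold hD hm hb hP hlam hC_P hC
  obtain ⟨a, ha, hax⟩ := nhds_basis_closedBall.mem_iff.1 (hΩ.mem_nhds hxΩ)
  obtain ⟨K, hK, hKx⟩ := hD.exists_ball_mul_le 8 1
  obtain ⟨r₁, hr₁, h1⟩ := measure_inter_le_of_mem_essExt hx (ε := (K + 1)⁻¹)
    (ENNReal.inv_ne_zero.2 (by finiteness)) (h0 x) (hi x)
  obtain ⟨η, hη, hηle⟩ : ∃ η > 0, η ≤ R ∧ η ≤ a / 2 ∧ η ≤ r₁ :=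
    ⟨min R (min (a / 2) r₁), by positivity, by simp⟩
  obtain ⟨hηR, hηa, hηr⟩ := hηle
  obtain ⟨y, hyη, hy⟩ : ∃ y ∈ ball x η, y ∈ essExt m Eᶜ := by
    by_contra! hno
    refine hux η hη (measure_mono_null (fun y hy => ?_)
      (ae_iff.1 (hD.ae_mem_essExt hm hb hE.measurableSet.compl)))
    simp only [mem_ofPred_eq, mem_compl_iff, not_not, Classical.not_imp]
    exact ⟨hy.1, hno y hy.2⟩
  set d := dist x y with hd
  have hdη : d < η := by rw [hd, dist_comm]; exact hyη
  have hd0 : 0 < d := dist_pos.2 fun h =>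
    notMem_essExt_compl hE.measurableSet (h0 x) (hi x) hx (h ▸ hy)
  have hxa : closedBall x (2 * d) ⊆ Ω := (closedBall_subset_closedBall (by linarith)).trans hax
  have hyΩ : y ∈ Ω := hxa (by rw [mem_closedBall, dist_comm]; linarith)
  obtain ⟨r₀, hr₀, hyr₀⟩ := hcompl y hyΩ hy
  have hyd : m (Eᶜ ∩ ball y d) ≠ 0 := by
    intro hnull
    obtain ⟨p, hp⟩ := hlen.exists_ball_subset (x := y) (y := x) hd0 (dist_comm x y).le
    rw [dist_comm y x] at hp
    have hpx : dist p x < d := (hp (mem_ball_self (by positivity))).2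
    have h2 : m (ball p (d / 4)) ≤ m (E ∩ ball x d) := by
      rw [← measure_inter_add_sdiff (ball p (d / 4)) hE.measurableSet,
        measure_mono_null (show ball p (d / 4) \ E ⊆ Eᶜ ∩ ball y d from
          fun z hz => ⟨hz.2, (hp hz.1).1⟩) hnull, add_zero]
      exact measure_mono fun z hz => ⟨hz.2, (hp hz.1).2⟩
    have h3 : m (ball x d) ≤ K * m (ball p (d / 4)) :=
      (measure_mono (ball_subset_ball' (by rw [dist_comm]; linarith))).trans
        (hKx p (d / 4) (by positivity) (by linarith))
    have h4 : (K + 1) * m (ball x d) ≤ K * m (ball x d) :=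
      calc (K + 1) * m (ball x d) ≤ (K + 1) * (K * ((K + 1)⁻¹ * m (ball x d))) := by
            gcongr
            exact h3.trans (by gcongr; exact h2.trans (h1 d hd0 (hdη.trans_le hηr)))
        _ = (K + 1) * (K + 1)⁻¹ * (K * m (ball x d)) := by ring
        _ = K * m (ball x d) := by
            rw [ENNReal.mul_inv_cancel (by simp) (by finiteness), one_mul]
    rw [add_mul, one_mul] at h4
    exact h0 x d hd0 (by
      simpa using (ENNReal.add_le_add_iff_left (ENNReal.mul_ne_top hK (hi x d))).1
        (h4.trans (add_zero _).ge))
  obtain ⟨L, hLd, hL⟩ : ∃ L < d, m (Eᶜ ∩ ball y L) ≠ 0 := by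
    by_contra! hno
    refine hyd (measure_mono_null (fun z hz => mem_iUnion.2 ?_)
      (measure_iUnion_null fun n : ℕ => hno (d - 1 / (n + 1))
        (sub_lt_self d Nat.one_div_pos_of_nat)))
    obtain ⟨n, hn⟩ := exists_nat_one_div_lt (sub_pos.2 (mem_ball.1 hz.2))
    exact ⟨n, hz.1, mem_ball.2 (by linarith)⟩
  have hL0 : 0 < L := by
    by_contra hL0
    exact hL (by rw [ball_eq_empty.2 (not_lt.1 hL0), inter_empty, measure_empty])
  obtain ⟨L', hLL', hL'd⟩ := exists_between hLd
  obtain ⟨r₂, hr₂, h2⟩ := exists_radius_of_mem_essExt hx (h0 x) (hi x) hε hL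
  have hdL' : 0 < d - L' := sub_pos.2 hL'd
  obtain ⟨r, hr, hr'⟩ := exists_between (show 0 < min r₂ (min (d - L') (min r₀ (min 1 L))) by
    positivity)
  simp only [lt_min_iff] at hr'
  obtain ⟨hrr₂, hrd, hrr₀, hr1, hrL⟩ := hr'
  obtain ⟨h2d, h2v⟩ := h2 r hr hrr₂
  refine hux (r / 2) (by positivity) (hth E Ω x y x r (d - L') (r / 2) L L' R hE
    (fun t ht => hlen.measure_sphere hD hm hb y ht) (by linarith)
    ((closedBall_subset_closedBall (by linarith)).trans hxa)
    ((closedBall_subset_closedBall' ?_).trans hxa) hr hr1 hrd le_rfl (by linarith) hLL'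
    (by linarith) hdefx ((ball_subset_ball hηR) hyη) ?_ h2v h2d)
  · rw [dist_comm]; linarith
  · rw [measure_mono_null (inter_subset_inter_right _ (ball_subset_ball (by linarith))) hyr₀]
    exact zero_le

end Regularity

section Topology

variable [MetricSpace X] [MeasurableSpace X] {m : Measure X} {E Ω : Set X}

lemma isOpen_essExt_inter (hΩ : IsOpen Ω)
    (h : ∀ x ∈ Ω, x ∈ essExt m E → ∃ r > 0, m (E ∩ ball x r) = 0) :
    IsOpen (essExt m E ∩ Ω) := by
  refine isOpen_iff_mem_nhds.2 fun x hx => ?_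
  obtain ⟨r, hr, hxr⟩ := h x hx.2 hx.1
  filter_upwards [ball_mem_nhds x hr, hΩ.mem_nhds hx.2] with y hy hyΩ
  refine ⟨mem_essExt_of_measure_eq_zero (sub_pos.2 hy) (measure_mono_null
    (inter_subset_inter_right _ (ball_subset_ball' ?_)) hxr), hyΩ⟩
  linarith

/-- If a point does not lie in the essential exterior, it is a limit of points of density one. -/
lemma mem_closure_essExt_compl [BorelSpace X] [SecondCountableTopology X] {D : ℝ → ℝ} {x : X}
    (hD : UnifLocDoublingWith D m) (hm : m ≠ 0) (hb : BoundedlyFinite m) (hE : MeasurableSet E)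
    (hx : x ∉ essExt m E) : x ∈ closure (essExt m Eᶜ) := by
  refine Metric.mem_closure_iff.2 fun r hr => ?_
  by_contra! hno
  refine hx (mem_essExt_of_measure_eq_zero hr (measure_mono_null (fun y hy => ?_)
    (ae_iff.1 (hD.ae_mem_essExt hm hb hE.compl))))
  simp only [mem_ofPred_eq, mem_compl_iff, not_not, Classical.not_imp]
  exact ⟨hy.1, fun h => (hno y h).not_gt (by rw [dist_comm]; exact hy.2)⟩

lemma frontier_inter_eq {Y : Type*} [TopologicalSpace Y] {A B U : Set Y}
    (hA : IsOpen (A ∩ U)) (hB : IsOpen (B ∩ U)) (hAB : Disjoint A B)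
    (h : ∀ x ∈ U, x ∉ B → x ∈ closure A) : frontier A ∩ U = (A ∪ B)ᶜ ∩ U := by
  ext x
  refine and_congr_left fun hxU => ?_
  rw [mem_compl_iff, mem_union, not_or]
  constructor
  · intro hx
    refine ⟨fun hxA => hx.2 (interior_maximal inter_subset_left hA ⟨hxA, hxU⟩), fun hxB => ?_⟩
    obtain ⟨z, hz, hzA⟩ := mem_closure_iff.1 hx.1 _ hB ⟨hxB, hxU⟩
    exact disjoint_left.1 hAB hzA hz.1
  · exact fun hx => ⟨h x hxU hx.2, fun hxA => hx.1 (interior_subset hxA)⟩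

end Topology

/-- **Localized topological regularity** (Remark 3.9(ii)): a volume-constrained
minimizer of the perimeter in an open set `Ω` with `P(E, Ω) > 0` has open essential
interior and exterior inside `Ω`, and the three boundaries coincide in `Ω`. -/
theorem localized_topological_regularity
    {X : Type*} [MetricSpace X] [CompleteSpace X] [TopologicalSpace.SeparableSpace X]
    [MeasurableSpace X] [BorelSpace X] (m : Measure X)
    (hbf : BoundedlyFinite m) (hPI : IsPIspace m) (hlen : IsLengthSpace X)
    (hdef : DeformationProperty m) (Ω : Set X) (hΩ : IsOpen Ω)
    (E : Set X) (hEm : MeasurableSet E) (hEp : HasLocFinPer m E)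
    (hmin : ∀ F K : Set X, MeasurableSet F → IsCompact K → K ⊆ Ω →
      m ((E ∆ F) \ K) = 0 → m (E ∩ K) = m (F ∩ K) → Per m E K ≤ Per m F K)
    (hP : 0 < Per m E Ω) :
    IsOpen (essInt m E ∩ Ω) ∧ IsOpen (essExt m E ∩ Ω) ∧
    frontier (essInt m E) ∩ Ω = essBdry m E ∩ Ω ∧
    frontier (essExt m E) ∩ Ω = essBdry m E ∩ Ω := by
  obtain ⟨⟨D, -, hD⟩, lam, hlam, C_P, hC_P, hPo⟩ := hPI
  have hm : m ≠ 0 := by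
    rintro rfl
    refine hP.ne' (le_antisymm ?_ zero_le)
    refine (per_mono (subset_univ Ω)).trans
      ((per_le_liminf (f := fun _ _ => 0) isOpen_univ (fun _ => locLipOn_const _ _) ?_).trans ?_)
    · intro K _ _
      simp
    · simp
  have := hD.properSpace hm hbf
  have hE : IsVolConstMinIn m Ω E := ⟨hEm, hEp, hmin⟩
  have hE' := hE.compl hbf
  have hint : essExt m Eᶜ = essInt m E := by
    ext x
    exact essExt_compl hEm (fun r hr => hD.measure_ball_ne_zero hm x hr)
      (hbf.measure_ball_ne_top x)
  have hdisj : Disjoint (essExt m E) (essExt m Eᶜ) := disjoint_left.2 fun x =>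
    notMem_essExt_compl hEm (fun r hr => hD.measure_ball_ne_zero hm x hr)
      (hbf.measure_ball_ne_top x)
  have hext : ∀ x ∈ Ω, x ∈ essExt m E → ∃ r > 0, m (E ∩ ball x r) = 0 := by
    intro x hxΩ hx
    by_contra hcon
    exact hcon (hE.exists_measure_eq_zero_of_compl hD hm hbf hPo hlam (hC_P 1 one_pos) hlen hdef hΩ
      hxΩ hx fun y hyΩ hy => (hE.exists_measure_eq_zero_or hD hm hbf hPo hlam (hC_P 1 one_pos)
        hlen hdef hΩ hxΩ hyΩ hx hy).resolve_left hcon)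
  have hext' : ∀ x ∈ Ω, x ∈ essExt m Eᶜ → ∃ r > 0, m (Eᶜ ∩ ball x r) = 0 := fun x hxΩ hx =>
    hE'.exists_measure_eq_zero_of_compl hD hm hbf hPo hlam (hC_P 1 one_pos) hlen hdef hΩ
      hxΩ hx (by simpa only [compl_compl] using hext)
  have ho := isOpen_essExt_inter hΩ hext
  have ho' := isOpen_essExt_inter hΩ hext'
  rw [essBdry, ← hint]
  refine ⟨ho', ho, frontier_inter_eq ho' ho hdisj.symm fun x _ hx =>
    mem_closure_essExt_compl hD hm hbf hEm hx, ?_⟩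
  rw [union_comm]
  refine frontier_inter_eq ho ho' hdisj fun x _ hx => ?_
  simpa only [compl_compl] using mem_closure_essExt_compl hD hm hbf hEm.compl hx

end
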